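/- Let W be a d-dimensional Brownian sheet on [0,1]^2 and let M̃ > 0. There exist constants ζ > 0 and C̃₂ > 0 such that for every function f : [0,1]^2 × ℝ^d → ℝ that is jointly continuous, bounded, continuously differentiable in the space variable, componentwise nondecreasing in the space variable, and satisfies |f(s,t,x)| ≤ M̃(1+|x|) for all (s,t,x), for every i ∈ {1,...,d} and every 0 < r < s ≤ 1, 0 < u < t ≤ 1, one has E[ exp( (ζ / (√(s−r) √(t−u))) ∫_r^s ∫_u^t ∂_{x_i} f(s₁,t₁, W_{s₁,t₁}) dt₁ ds₁ ) ] ≤ C̃₂. -/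

import Mathlib

open MeasureTheory ProbabilityTheory Set Filter

noncomputable section

/-- A `d`-dimensional Brownian sheet on `[0,1]²`. -/
def IsBrownianSheet {Ω : Type*} [MeasurableSpace Ω] (P : Measure Ω) (d : ℕ)
    (W : ℝ × ℝ → Ω → EuclideanSpace ℝ (Fin d)) : Prop :=
  (∀ p, Measurable (W p)) ∧
  (∀ ω, ContinuousOn (fun p => W p ω) (Set.Icc (0 : ℝ × ℝ) 1)) ∧
  (∀ ω, ∀ p ∈ Set.Icc (0 : ℝ × ℝ) 1, p.1 = 0 ∨ p.2 = 0 → W p ω = 0) ∧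
  (∀ (n : ℕ) (p : Fin n → ℝ × ℝ) (idx : Fin n → Fin d) (c : Fin n → ℝ),
    (∀ j, p j ∈ Set.Icc (0 : ℝ × ℝ) 1) →
    P.map (fun ω => ∑ j, c j * W (p j) ω (idx j)) =
      gaussianReal 0 (∑ j, ∑ k, c j * c k *
        (if idx j = idx k then min (p j).1 (p k).1 * min (p j).2 (p k).2 else 0)).toNNReal)

/-- The σ-algebra generated by the sheet up to `p`. -/
def sheetSigma {Ω : Type*} [MeasurableSpace Ω] {d : ℕ}
    (W : ℝ × ℝ → Ω → EuclideanSpace ℝ (Fin d)) (p : ℝ × ℝ) : MeasurableSpace Ω :=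
  ⨆ q ∈ Set.Icc (0 : ℝ × ℝ) p, MeasurableSpace.comap (W q) inferInstance

/-- A strong solution of the sheet SDE. -/
def IsStrongSolution {Ω : Type*} [MeasurableSpace Ω] (P : Measure Ω) {d : ℕ}
    (W : ℝ × ℝ → Ω → EuclideanSpace ℝ (Fin d))
    (b : ℝ × ℝ → EuclideanSpace ℝ (Fin d) → EuclideanSpace ℝ (Fin d))
    (ξ : EuclideanSpace ℝ (Fin d))
    (X : ℝ × ℝ → Ω → EuclideanSpace ℝ (Fin d)) : Prop :=
  (∀ ω, ContinuousOn (fun p => X p ω) (Set.Icc (0 : ℝ × ℝ) 1)) ∧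
  (∀ p ∈ Set.Icc (0 : ℝ × ℝ) 1, ∃ Y : Ω → EuclideanSpace ℝ (Fin d),
      Measurable[sheetSigma W p] Y ∧ ∀ᵐ ω ∂P, X p ω = Y ω) ∧
  (∀ᵐ ω ∂P, ∀ p ∈ Set.Icc (0 : ℝ × ℝ) 1,
      X p ω = ξ + (∫ t₁ in (0:ℝ)..p.2, ∫ s₁ in (0:ℝ)..p.1, b (s₁, t₁) (X (s₁, t₁) ω)) + W p ω)

lemma ofReal_integral_le_lintegral_ofReal_of_abs_le {α : Type*} [MeasurableSpace α]
    {μ : Measure α} {F G : α → ℝ} (h : ∀ x, |F x| ≤ G x) :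
    ENNReal.ofReal (∫ x, F x ∂μ) ≤ ∫⁻ x, ENNReal.ofReal (G x) ∂μ := by
  calc ENNReal.ofReal (∫ x, F x ∂μ) ≤ ‖∫ x, F x ∂μ‖ₑ := by
        rw [← ofReal_norm]; exact ENNReal.ofReal_le_ofReal (le_abs_self _)
    _ ≤ ∫⁻ x, ‖F x‖ₑ ∂μ := enorm_integral_le_lintegral_enorm _
    _ ≤ _ := lintegral_mono fun x => by
        rw [← ofReal_norm]; exact ENNReal.ofReal_le_ofReal (h x)

lemma lintegral_gaussianReal_mul_exp (F : ℝ → ℝ) (hF : Measurable F) :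
    ∫⁻ y, ENNReal.ofReal (F y * Real.exp (y ^ 2 / 4)) ∂(gaussianReal 0 1)
      = ∫⁻ y, ENNReal.ofReal (F y * ((√(2 * Real.pi))⁻¹ * Real.exp (-(1 / 4) * y ^ 2))) := by
  rw [gaussianReal_of_var_ne_zero _ one_ne_zero,
    lintegral_withDensity_eq_lintegral_mul _ (measurable_gaussianPDF 0 1) (by fun_prop)]
  refine lintegral_congr fun y => ?_
  simp only [Pi.mul_apply, gaussianPDF, gaussianPDFReal]
  rw [← ENNReal.ofReal_mul (by positivity)]
  congr 1
  have : Real.exp (-(1 / 4) * y ^ 2)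
      = Real.exp (-(y - 0) ^ 2 / (2 * ((1 : NNReal) : ℝ))) * Real.exp (y ^ 2 / 4) := by
    rw [← Real.exp_add]; congr 1; push_cast; ring
  rw [this]; push_cast; ring_nf

/-- Gaussian integration by parts for difference quotients of monotone functions. -/
lemma lintegral_diffQuot_gaussianReal_le {φ : ℝ → ℝ} (hφ : Continuous φ) (hm : Monotone φ)
    {B : ℝ} (hB : ∀ y, |φ y| ≤ B) {h σ : ℝ} (hh : 0 < h) (hσ : 0 < σ) {K : ℝ → ℝ}
    (hKm : Measurable K) (hK : ∀ y, ∀ w ∈ Icc 0 h, |φ (σ * y + w)| ≤ K y) :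
    ∫⁻ y, ENNReal.ofReal ((φ (σ * y + h) - φ (σ * y)) / h * Real.exp (y ^ 2 / 4))
        ∂(gaussianReal 0 1)
      ≤ ∫⁻ y, ENNReal.ofReal (K y * |y| / (2 * σ) * Real.exp (y ^ 2 / 4))
        ∂(gaussianReal 0 1) := by
  rw [lintegral_gaussianReal_mul_exp _ (by fun_prop), lintegral_gaussianReal_mul_exp _ (by fun_prop)]
  set c : ℝ := (√(2 * Real.pi))⁻¹ with hc
  have hc0 : 0 ≤ c := by positivity
  let ρ : ℝ → ℝ := fun y => c * Real.exp (-(1 / 4) * y ^ 2)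
  let D : ℝ → ℝ := fun y => (φ (σ * y + h) - φ (σ * y)) / h
  let u : ℝ → ℝ := fun y => ((∫ z in (0:ℝ)..(σ * y + h), φ z) - ∫ z in (0:ℝ)..(σ * y), φ z) / h
  have hu_eq : ∀ y, u y = (∫ z in (σ * y)..(σ * y + h), φ z) / h := fun y => by
    simp only [u]
    rw [intervalIntegral.integral_interval_sub_left (hφ.intervalIntegrable _ _)
      (hφ.intervalIntegrable _ _)]
  have hub : ∀ y b, (∀ w ∈ Icc 0 h, |φ (σ * y + w)| ≤ b) → |u y| ≤ b := fun y b hb => by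
    rw [hu_eq, abs_div, abs_of_pos hh, div_le_iff₀ hh]
    have := intervalIntegral.norm_integral_le_of_norm_le_const (f := φ) (C := b)
      (a := σ * y) (b := σ * y + h) (fun z hz => by
        rw [uIoc_of_le (by linarith)] at hz
        have := hb (z - σ * y) ⟨by linarith [hz.1], by linarith [hz.2]⟩
        simpa using this)
    simpa [abs_of_pos hh] using this
  have hderiv : ∀ a y, HasDerivAt (fun y => ∫ z in (0:ℝ)..(σ * y + a), φ z)
      (φ (σ * y + a) * σ) y := fun a y => by
    have h1 := (hφ.integral_hasStrictDerivAt 0 (σ * y + a)).hasDerivAt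
    have h2 : HasDerivAt (fun y => σ * y + a) σ y := by
      simpa using ((hasDerivAt_id y).const_mul σ).add_const a
    exact HasDerivAt.comp y h1 h2
  have hu : ∀ y, HasDerivAt u (σ * D y) y := fun y => by
    have h0 : HasDerivAt (fun y => ∫ z in (0:ℝ)..(σ * y), φ z) (φ (σ * y) * σ) y := by
      simpa using hderiv 0 y
    exact (((hderiv h y).sub h0).div_const h).congr_deriv (by simp only [D]; ring)
  have hρ : ∀ y, HasDerivAt ρ (-(y / 2) * ρ y) y := fun y => by
    have h1 : HasDerivAt (fun y : ℝ => -(1 / 4) * y ^ 2) (-(1 / 4) * (2 * y)) y := by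
      simpa using (hasDerivAt_pow 2 y).const_mul (-(1 / 4) : ℝ)
    exact (h1.exp.const_mul c).congr_deriv (by simp only [ρ]; ring)
  have hρi : Integrable ρ := (integrable_exp_neg_mul_sq (by norm_num : (0:ℝ) < 1 / 4)).const_mul c
  have hρ'i : Integrable (fun y => -(y / 2) * ρ y) := by
    have := (integrable_mul_exp_neg_mul_sq (by norm_num : (0:ℝ) < 1 / 4)).const_mul (-c / 2)
    refine this.congr (ae_of_all _ fun y => ?_)
    simp only [ρ]; ring
  have huc : Continuous u := continuous_iff_continuousAt.2 fun y => (hu y).continuousAt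
  have hDc : Continuous D := by simp only [D]; fun_prop
  have huB : ∀ y, |u y| ≤ B := fun y => hub y B fun w _ => hB _
  have hDB : ∀ y, ‖σ * D y‖ ≤ σ * (2 * B / h) := fun y => by
    rw [Real.norm_eq_abs, abs_mul, abs_of_pos hσ]
    refine mul_le_mul_of_nonneg_left ?_ hσ.le
    simp only [D]
    rw [abs_div, abs_of_pos hh]
    refine div_le_div_of_nonneg_right ?_ hh.le
    have := abs_sub (φ (σ * y + h)) (φ (σ * y))
    linarith [hB (σ * y + h), hB (σ * y)]
  have ibp := integral_mul_deriv_eq_deriv_mul_of_integrable (u := u) (v := ρ)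
    (fun y _ => hu y) (fun y _ => hρ y)
    (hρ'i.bdd_mul huc.aestronglyMeasurable (ae_of_all _ huB))
    (hρi.bdd_mul (continuous_const.mul hDc).aestronglyMeasurable (ae_of_all _ hDB))
    (hρi.bdd_mul huc.aestronglyMeasurable (ae_of_all _ huB))
  have hDρi : Integrable (fun y => D y * ρ y) := by
    have := (hρi.bdd_mul (continuous_const.mul hDc).aestronglyMeasurable
      (ae_of_all _ hDB)).const_mul σ⁻¹
    refine this.congr (ae_of_all _ fun y => ?_)
    simp only [Pi.mul_apply]
    field_simp
  have key : ∫ y, D y * ρ y = ∫ y, u y * (y / (2 * σ)) * ρ y := by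
    have e1 : ∫ y, u y * (-(y / 2) * ρ y) = -σ * ∫ y, u y * (y / (2 * σ)) * ρ y := by
      rw [← integral_const_mul]; congr 1; ext y; field_simp
    have e2 : ∫ y, σ * D y * ρ y = σ * ∫ y, D y * ρ y := by
      rw [← integral_const_mul]; congr 1; ext y; ring
    rw [e1, e2] at ibp
    have : σ * ∫ y, D y * ρ y = σ * ∫ y, u y * (y / (2 * σ)) * ρ y := by linarith
    exact mul_left_cancel₀ hσ.ne' this
  have hD0 : ∀ y, 0 ≤ D y := fun y =>
    div_nonneg (sub_nonneg.2 (hm (by linarith))) hh.le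
  have hρ0 : ∀ y, 0 ≤ ρ y := fun y => by simp only [ρ]; positivity
  calc ∫⁻ y, ENNReal.ofReal (D y * ρ y) = ENNReal.ofReal (∫ y, D y * ρ y) :=
        (ofReal_integral_eq_lintegral_ofReal hDρi
          (ae_of_all _ fun y => mul_nonneg (hD0 y) (hρ0 y))).symm
    _ = ENNReal.ofReal (∫ y, u y * (y / (2 * σ)) * ρ y) := by rw [key]
    _ ≤ _ := ofReal_integral_le_lintegral_ofReal_of_abs_le fun y => by
        rw [abs_mul, abs_mul, abs_of_nonneg (hρ0 y), abs_div y,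
          abs_of_pos (by positivity : 0 < 2 * σ), mul_div_assoc]
        exact mul_le_mul_of_nonneg_right
          (mul_le_mul_of_nonneg_right (hub y _ (hK y)) (by positivity)) (hρ0 y)

lemma norm_toLp_update_sq {d : ℕ} (z : Fin d → ℝ) (i : Fin d) (y : ℝ) :
    ‖WithLp.toLp 2 (Function.update z i y)‖ ^ 2
      = ‖WithLp.toLp 2 (Function.update z i 0)‖ ^ 2 + y ^ 2 := by
  rw [EuclideanSpace.norm_sq_eq, EuclideanSpace.norm_sq_eq,
    ← Finset.add_sum_erase _ _ (Finset.mem_univ i), ← Finset.add_sum_erase _ _ (Finset.mem_univ i)]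
  have : ∀ w : ℝ, ∑ j ∈ Finset.univ.erase i, ‖Function.update z i w j‖ ^ 2
      = ∑ j ∈ Finset.univ.erase i, ‖z j‖ ^ 2 := fun w =>
    Finset.sum_congr rfl fun j hj => by
      rw [Function.update_of_ne (Finset.ne_of_mem_erase hj)]
  simp only [this, Function.update_self]
  simp [add_comm]

lemma toLp_update_eq {d : ℕ} (z : Fin d → ℝ) (i : Fin d) (y : ℝ) :
    WithLp.toLp 2 (Function.update z i y)
      = WithLp.toLp 2 (Function.update z i 0) + y • EuclideanSpace.single i (1 : ℝ) := by
  ext j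
  by_cases hj : j = i
  · subst hj; simp
  · simp [hj]

lemma two_add_mul_le_exp {a : ℝ} : (2 + a) * a ≤ 16 * Real.exp (a ^ 2 / 8) := by
  nlinarith [Real.add_one_le_exp (a ^ 2 / 8), sq_nonneg (a - 1)]

/-- The exponential square moment of the standard Gaussian measure. -/
def gaussExpMoment (d : ℕ) : ENNReal :=
  ∫⁻ z, ENNReal.ofReal (Real.exp (3 / 8 * ‖z‖ ^ 2)) ∂(stdGaussian (EuclideanSpace ℝ (Fin d)))

lemma gaussExpMoment_ne_top (d : ℕ) : gaussExpMoment d ≠ ⊤ := by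
  have h1 : Integrable (fun y : ℝ => Real.exp (3 / 8 * y ^ 2)) (gaussianReal 0 1) := by
    rw [gaussianReal_of_var_ne_zero _ one_ne_zero,
      integrable_withDensity_iff_integrable_smul₀' (measurable_gaussianPDF 0 1).aemeasurable
        (ae_of_all _ fun _ => ENNReal.ofReal_lt_top)]
    refine ((integrable_exp_neg_mul_sq (by norm_num : (0:ℝ) < 1 / 8)).const_mul
      (√(2 * Real.pi))⁻¹).congr (ae_of_all _ fun y => ?_)
    have : (0 : ℝ) ≤ gaussianPDFReal 0 1 y := gaussianPDFReal_nonneg _ _ _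
    simp only [gaussianPDF, ENNReal.toReal_ofReal this, smul_eq_mul]
    simp only [gaussianPDFReal]
    push_cast
    rw [mul_assoc, ← Real.exp_add]
    ring_nf
  have h2 := Integrable.fintype_prod (ι := Fin d) (f := fun _ => fun y : ℝ => Real.exp (3 / 8 * y ^ 2))
    (μ := fun _ => gaussianReal 0 1) (fun _ => h1)
  rw [gaussExpMoment, ← map_pi_eq_stdGaussian, lintegral_map (by fun_prop) (by fun_prop)]
  have h3 := h2.lintegral_lt_top.ne
  convert h3 using 5 with z
  rw [EuclideanSpace.norm_sq_eq, Finset.mul_sum, Real.exp_sum]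
  simp

lemma lintegral_diffQuot_stdGaussian_le {d : ℕ} {g : EuclideanSpace ℝ (Fin d) → ℝ}
    (hg : Continuous g) (hm : ∀ x y : EuclideanSpace ℝ (Fin d), (∀ i, x i ≤ y i) → g x ≤ g y)
    {B : ℝ} (hB : ∀ x, |g x| ≤ B) {M : ℝ} (hM : 0 < M) (hgM : ∀ x, |g x| ≤ M * (1 + ‖x‖))
    (i : Fin d) {h σ : ℝ} (hh : 0 < h) (hh1 : h ≤ 1) (hσ : 0 < σ) (hσ1 : σ ≤ 1)
    (x : EuclideanSpace ℝ (Fin d)) :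
    ∫⁻ z, ENNReal.ofReal ((g (x + σ • z + h • EuclideanSpace.single i 1) - g (x + σ • z)) / h
        * Real.exp (‖z‖ ^ 2 / 4)) ∂(stdGaussian (EuclideanSpace ℝ (Fin d)))
      ≤ ENNReal.ofReal (16 * M * (1 + ‖x‖) / σ) * gaussExpMoment d := by
  have step1 : ∫⁻ z, ENNReal.ofReal ((g (x + σ • z + h • EuclideanSpace.single i 1)
        - g (x + σ • z)) / h * Real.exp (‖z‖ ^ 2 / 4)) ∂(stdGaussian (EuclideanSpace ℝ (Fin d)))
      ≤ ∫⁻ z : EuclideanSpace ℝ (Fin d), ENNReal.ofReal (M * (1 + ‖x‖) * (2 + ‖z‖) * |z i| / (2 * σ)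
        * Real.exp (‖z‖ ^ 2 / 4)) ∂(stdGaussian (EuclideanSpace ℝ (Fin d))) := by
    rw [← map_pi_eq_stdGaussian, lintegral_map (by fun_prop) (by fun_prop),
      lintegral_map (by fun_prop) (by fun_prop)]
    refine lintegral_le_of_lmarginal_le {i} (by fun_prop) (by fun_prop) fun z => ?_
    rw [lmarginal_singleton, lmarginal_singleton]
    set e : EuclideanSpace ℝ (Fin d) := EuclideanSpace.single i 1 with he
    have hen : ‖e‖ = 1 := by simp [he]
    set z0 := WithLp.toLp 2 (Function.update z i 0) with hz0
    have hz : ∀ y, WithLp.toLp 2 (Function.update z i y) = z0 + y • e := toLp_update_eq z i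
    have hn : ∀ y, ‖WithLp.toLp 2 (Function.update z i y)‖ ^ 2 = ‖z0‖ ^ 2 + y ^ 2 :=
      norm_toLp_update_sq z i
    have key := lintegral_diffQuot_gaussianReal_le (φ := fun y => g (x + σ • z0 + y • e))
      (by fun_prop)
      (fun a b hab => hm _ _ fun j => by
        have : (0:ℝ) ≤ e j := by
          simp only [he, PiLp.single_apply]; split_ifs <;> norm_num
        simpa using mul_le_mul_of_nonneg_right hab this)
      (fun y => hB _) hh hσ
      (K := fun y => M * (1 + ‖x‖) * (2 + ‖WithLp.toLp 2 (Function.update z i y)‖))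
      (by simp only [hz]; fun_prop)
      (fun y w hw => by
        refine (hgM _).trans ?_
        rw [mul_assoc]
        refine mul_le_mul_of_nonneg_left ?_ hM.le
        have e1 : x + σ • z0 + (σ * y + w) • e
            = x + σ • WithLp.toLp 2 (Function.update z i y) + w • e := by
          rw [hz]; module
        rw [e1]
        have n1 := norm_add_le (x + σ • WithLp.toLp 2 (Function.update z i y)) (w • e)
        have n2 := norm_add_le x (σ • WithLp.toLp 2 (Function.update z i y))
        rw [norm_smul, Real.norm_eq_abs, abs_of_nonneg hw.1, hen] at n1
        rw [norm_smul, Real.norm_eq_abs, abs_of_pos hσ] at n2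
        have n3 := mul_le_mul_of_nonneg_right hσ1
          (norm_nonneg (WithLp.toLp 2 (Function.update z i y)))
        nlinarith [hw.2, norm_nonneg x, norm_nonneg (WithLp.toLp 2 (Function.update z i y))])
    have split : ∀ (F : ℝ → ℝ), ∫⁻ y, ENNReal.ofReal (F y *
          Real.exp (‖WithLp.toLp 2 (Function.update z i y)‖ ^ 2 / 4)) ∂(gaussianReal 0 1)
        = (∫⁻ y, ENNReal.ofReal (F y * Real.exp (y ^ 2 / 4)) ∂(gaussianReal 0 1))
          * ENNReal.ofReal (Real.exp (‖z0‖ ^ 2 / 4)) := fun F => by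
      rw [← lintegral_mul_const' _ _ ENNReal.ofReal_ne_top]
      refine lintegral_congr fun y => ?_
      rw [← ENNReal.ofReal_mul' (Real.exp_nonneg _), hn, add_div, Real.exp_add]
      ring_nf
    beta_reduce
    rw [split, split]
    refine mul_le_mul_left ?_ _
    convert key using 5 with y y
    · have e1 : x + σ • WithLp.toLp 2 (Function.update z i y) + h • e
          = x + σ • z0 + (σ * y + h) • e := by rw [hz]; module
      have e2 : x + σ • WithLp.toLp 2 (Function.update z i y)
          = x + σ • z0 + (σ * y) • e := by rw [hz]; module
      rw [e1, e2]
    · simp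
  refine step1.trans ?_
  rw [gaussExpMoment, ← lintegral_const_mul _ (by fun_prop)]
  refine lintegral_mono fun z => ?_
  rw [← ENNReal.ofReal_mul (by positivity)]
  refine ENNReal.ofReal_le_ofReal ?_
  have hzi : |z i| ≤ ‖z‖ := by simpa using PiLp.norm_apply_le z i
  calc M * (1 + ‖x‖) * (2 + ‖z‖) * |z i| / (2 * σ) * Real.exp (‖z‖ ^ 2 / 4)
      ≤ M * (1 + ‖x‖) * (2 + ‖z‖) * ‖z‖ / (1 * σ) * Real.exp (‖z‖ ^ 2 / 4) := by
        gcongr; norm_num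
    _ = M * (1 + ‖x‖) / σ * ((2 + ‖z‖) * ‖z‖) * Real.exp (‖z‖ ^ 2 / 4) := by ring
    _ ≤ M * (1 + ‖x‖) / σ * (16 * Real.exp (‖z‖ ^ 2 / 8)) * Real.exp (‖z‖ ^ 2 / 4) := by
        refine mul_le_mul_of_nonneg_right (mul_le_mul_of_nonneg_left two_add_mul_le_exp ?_) ?_ <;>
          positivity
    _ = 16 * M * (1 + ‖x‖) / σ * (Real.exp (‖z‖ ^ 2 / 8) * Real.exp (‖z‖ ^ 2 / 4)) := by ring
    _ = _ := by rw [← Real.exp_add]; ring_nf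

lemma prod_Ioc_one_add_eq {R : Type*} [CommSemiring R] (a : ℕ → R) (k m : ℕ) :
    ∏ j ∈ Finset.Ioc k (k + m), (1 + a j)
      = 1 + ∑ j ∈ Finset.Ioc k (k + m), a j * ∏ l ∈ Finset.Ioc j (k + m), (1 + a l) := by
  induction m generalizing k with
  | zero => simp
  | succ m ih =>
    have hI : Finset.Ioc k (k + (m + 1)) = insert (k + 1) (Finset.Ioc (k + 1) (k + 1 + m)) := by
      ext j; simp; omega
    have hk : k + (m + 1) = k + 1 + m := by omega
    rw [hI, Finset.prod_insert (by simp), Finset.sum_insert (by simp), hk, add_mul, one_mul,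
      ih (k + 1)]
    ring

/-- A discrete Khasminskii-type bound: a supersolution `A` of the renewal inequality dominates the
multiplicative functional of a chain with independent increments. -/
lemma lintegral_prod_one_add_le {Ω : Type*} [MeasurableSpace Ω] {P : Measure Ω}
    [IsProbabilityMeasure P] {E : Type*} [NormedAddCommGroup E] [MeasurableSpace E] [BorelSpace E]
    [SecondCountableTopology E] {X : ℕ → Ω → E} (hX : ∀ k, Measurable (X k)) (n : ℕ)
    (hind : ∀ k j, k < j → j ≤ n →
      IndepFun (fun ω i => X (min i k) ω) (fun ω => X j ω - X k ω) P)
    {b A : ℕ → E → ENNReal} (hb : ∀ k, Measurable (b k)) (hA : ∀ k, Measurable (A k))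
    (H : ∀ k ≤ n, ∀ x, 1 + ∑ j ∈ Finset.Ioc k n,
      ∫⁻ y, b j (x + y) * A j (x + y) ∂(P.map (fun ω => X j ω - X k ω)) ≤ A k x) :
    ∫⁻ ω, ∏ j ∈ Finset.Ioc 0 n, (1 + b j (X j ω)) ∂P ≤ ∫⁻ ω, A 0 (X 0 ω) ∂P := by
  let U : ℕ → Ω → ℕ → E := fun k ω i => X (min i k) ω
  have hU : ∀ k, Measurable (U k) := fun k => measurable_pi_lambda _ fun i => hX _
  have main : ∀ m k, k + m = n → ∀ ψ : (ℕ → E) → ENNReal, Measurable ψ →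
      ∫⁻ ω, ψ (U k ω) * ∏ j ∈ Finset.Ioc k n, (1 + b j (X j ω)) ∂P
        ≤ ∫⁻ ω, ψ (U k ω) * A k (X k ω) ∂P := by
    intro m
    induction m using Nat.strong_induction_on with
    | _ m ih =>
    intro k hk ψ hψ
    have hmeas : ∀ j, Measurable fun ω => ∏ l ∈ Finset.Ioc j n, (1 + b l (X l ω)) := fun j =>
      Finset.measurable_prod _ fun l _ => ((hb l).comp (hX l)).const_add 1
    have hterm : ∀ j ∈ Finset.Ioc k n,
        ∫⁻ ω, ψ (U k ω) * (b j (X j ω) * ∏ l ∈ Finset.Ioc j n, (1 + b l (X l ω))) ∂P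
          ≤ ∫⁻ ω, ψ (U k ω) * ∫⁻ y, b j (X k ω + y) * A j (X k ω + y)
              ∂(P.map (fun ω => X j ω - X k ω)) ∂P := by
      intro j hj
      rw [Finset.mem_Ioc] at hj
      have hψ' : Measurable fun u : ℕ → E => ψ (fun i => u (min i k)) * b j (u j) :=
        (hψ.comp (measurable_pi_lambda _ fun i => measurable_pi_apply _)).mul
          ((hb j).comp (measurable_pi_apply j))
      have h1 := ih (n - j) (by omega) j (by omega) _ hψ'
      have h2 : ∀ ω, (fun i => U j ω (min i k)) = U k ω := fun ω => by
        ext i; simp only [U]; congr 1; omega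
      have h3 : ∀ ω, U j ω j = X j ω := fun ω => by simp [U]
      simp only [h2, h3] at h1
      simp only [mul_assoc] at h1
      refine h1.trans (le_of_eq ?_)
      have hD : Measurable fun ω => X j ω - X k ω := (hX j).sub (hX k)
      have hjoint := (indepFun_iff_map_prod_eq_prod_map_map (hU k).aemeasurable
        hD.aemeasurable).1 (hind k j hj.1 hj.2)
      have hG : Measurable fun p : (ℕ → E) × E => ψ p.1 * (b j (p.1 k + p.2) * A j (p.1 k + p.2)) := by
        have : Measurable fun p : (ℕ → E) × E => p.1 k + p.2 :=
          ((measurable_pi_apply k).comp measurable_fst).add measurable_snd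
        exact (hψ.comp measurable_fst).mul (((hb j).comp this).mul ((hA j).comp this))
      have e1 : ∫⁻ ω, ψ (U k ω) * (b j (X j ω) * A j (X j ω)) ∂P
          = ∫⁻ p, ψ p.1 * (b j (p.1 k + p.2) * A j (p.1 k + p.2))
            ∂(P.map (fun ω => (U k ω, X j ω - X k ω))) := by
        rw [lintegral_map hG ((hU k).prodMk hD)]
        refine lintegral_congr fun ω => ?_
        have : U k ω k + (X j ω - X k ω) = X j ω := by simp [U]
        simp only [this]
      have : IsProbabilityMeasure (P.map (fun ω => X j ω - X k ω)) :=
        Measure.isProbabilityMeasure_map hD.aemeasurable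
      rw [e1, hjoint, lintegral_prod _ hG.aemeasurable, lintegral_map hG.lintegral_prod_right' (hU k)]
      refine lintegral_congr fun ω => ?_
      have hk' : U k ω k = X k ω := by simp [U]
      simp only [hk']
      rw [lintegral_const_mul]
      exact ((hb j).comp (measurable_const_add _)).mul ((hA j).comp (measurable_const_add _))
    have hψU : Measurable fun ω => ψ (U k ω) := hψ.comp (hU k)
    calc ∫⁻ ω, ψ (U k ω) * ∏ j ∈ Finset.Ioc k n, (1 + b j (X j ω)) ∂P
        = ∫⁻ ω, ψ (U k ω) + ∑ j ∈ Finset.Ioc k n,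
            ψ (U k ω) * (b j (X j ω) * ∏ l ∈ Finset.Ioc j n, (1 + b l (X l ω))) ∂P := by
          refine lintegral_congr fun ω => ?_
          subst hk
          rw [prod_Ioc_one_add_eq, mul_add, mul_one, Finset.mul_sum]
      _ = ∫⁻ ω, ψ (U k ω) ∂P + ∑ j ∈ Finset.Ioc k n, ∫⁻ ω,
            ψ (U k ω) * (b j (X j ω) * ∏ l ∈ Finset.Ioc j n, (1 + b l (X l ω))) ∂P := by
          rw [lintegral_add_left hψU, lintegral_finsetSum]
          exact fun j _ => hψU.mul (((hb j).comp (hX j)).mul (hmeas j))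
      _ ≤ ∫⁻ ω, ψ (U k ω) ∂P + ∑ j ∈ Finset.Ioc k n, ∫⁻ ω, ψ (U k ω) *
            ∫⁻ y, b j (X k ω + y) * A j (X k ω + y) ∂(P.map (fun ω => X j ω - X k ω)) ∂P := by
          exact add_le_add le_rfl (Finset.sum_le_sum hterm)
      _ ≤ ∫⁻ ω, ψ (U k ω) + ∑ j ∈ Finset.Ioc k n, ψ (U k ω) *
            ∫⁻ y, b j (X k ω + y) * A j (X k ω + y) ∂(P.map (fun ω => X j ω - X k ω)) ∂P := by
          rw [lintegral_add_left hψU]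
          gcongr
          rw [lintegral_finsetSum]
          intro j _
          have hD : Measurable fun ω => X j ω - X k ω := (hX j).sub (hX k)
          have : IsProbabilityMeasure (P.map (fun ω => X j ω - X k ω)) :=
            Measure.isProbabilityMeasure_map hD.aemeasurable
          have hG : Measurable fun p : E × E => b j (p.1 + p.2) * A j (p.1 + p.2) :=
            ((hb j).comp measurable_add).mul ((hA j).comp measurable_add)
          exact hψU.mul (hG.lintegral_prod_right'.comp (hX k))
      _ ≤ _ := by
          refine lintegral_mono fun ω => ?_
          have := mul_le_mul_right (H k (by omega) (X k ω)) (ψ (U k ω))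
          rwa [mul_add, mul_one, Finset.mul_sum] at this
  simpa using main n 0 (by omega) (fun _ => 1) measurable_const

lemma IsBrownianSheet.map_sum {Ω : Type*} [MeasurableSpace Ω] {P : Measure Ω} {d : ℕ}
    {W : ℝ × ℝ → Ω → EuclideanSpace ℝ (Fin d)} (hW : IsBrownianSheet P d W) {ι : Type*} [Fintype ι]
    (p : ι → ℝ × ℝ) (idx : ι → Fin d) (c : ι → ℝ) (hp : ∀ j, p j ∈ Set.Icc (0 : ℝ × ℝ) 1) :
    P.map (fun ω => ∑ j, c j * W (p j) ω (idx j)) =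
      gaussianReal 0 (∑ j, ∑ k, c j * c k *
        (if idx j = idx k then min (p j).1 (p k).1 * min (p j).2 (p k).2 else 0)).toNNReal := by
  let e := (Fintype.equivFin ι).symm
  have h := hW.2.2.2 _ (p ∘ e) (idx ∘ e) (c ∘ e) fun j => hp _
  simp only [Function.comp_apply] at h
  convert h using 3
  · exact (e.sum_comp fun j => c j * W (p j) _ (idx j)).symm
  · rw [← e.sum_comp]
    exact Finset.sum_congr rfl fun j _ => (e.sum_comp _).symm

lemma IsBrownianSheet.measurable_coord {Ω : Type*} [MeasurableSpace Ω] {P : Measure Ω} {d : ℕ}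
    {W : ℝ × ℝ → Ω → EuclideanSpace ℝ (Fin d)} (hW : IsBrownianSheet P d W) (p : ℝ × ℝ)
    (i : Fin d) : Measurable fun ω => W p ω i := by
  have := hW.1 p
  fun_prop

lemma IsBrownianSheet.isGaussianProcess {Ω : Type*} [MeasurableSpace Ω] {P : Measure Ω} {d : ℕ}
    {W : ℝ × ℝ → Ω → EuclideanSpace ℝ (Fin d)} (hW : IsBrownianSheet P d W) :
    IsGaussianProcess
      (fun (q : Set.Icc (0 : ℝ × ℝ) 1 × Fin d) ω => W (q.1 : ℝ × ℝ) ω q.2) P := by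
  classical
  refine ⟨fun I => ⟨isGaussian_of_map_eq_gaussianReal fun L => ?_⟩⟩
  have hm : Measurable fun ω => I.restrict
        (fun q : Set.Icc (0 : ℝ × ℝ) 1 × Fin d => W (q.1 : ℝ × ℝ) ω q.2) :=
    measurable_pi_lambda _ fun q => hW.measurable_coord _ _
  rw [Measure.map_map L.measurable hm]
  have := hW.map_sum (ι := I) (fun q => (q.1.1 : ℝ × ℝ)) (fun q => q.1.2)
    (fun q => L (fun j => if q = j then 1 else 0)) fun q => q.1.1.2
  refine ⟨0, _, Eq.trans ?_ this⟩
  congr 1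
  ext ω
  simp only [Function.comp_apply]
  have := LinearMap.pi_apply_eq_sum_univ (L : (I → ℝ) →ₗ[ℝ] ℝ) (I.restrict
    (fun q : Set.Icc (0 : ℝ × ℝ) 1 × Fin d => W (q.1 : ℝ × ℝ) ω q.2))
  simp only [ContinuousLinearMap.coe_coe, smul_eq_mul] at this
  rw [this]
  exact Finset.sum_congr rfl fun q _ => mul_comm _ _

lemma IsBrownianSheet.memLp_two {Ω : Type*} [MeasurableSpace Ω] {P : Measure Ω} {d : ℕ}
    {W : ℝ × ℝ → Ω → EuclideanSpace ℝ (Fin d)} (hW : IsBrownianSheet P d W) {p : ℝ × ℝ}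
    (hp : p ∈ Set.Icc (0 : ℝ × ℝ) 1) (i : Fin d) : MemLp (fun ω => W p ω i) 2 P :=
  (hW.isGaussianProcess.hasGaussianLaw_eval (⟨p, hp⟩, i)).memLp_two

lemma IsBrownianSheet.covariance_eq {Ω : Type*} [MeasurableSpace Ω] {P : Measure Ω}
    [IsProbabilityMeasure P] {d : ℕ}
    {W : ℝ × ℝ → Ω → EuclideanSpace ℝ (Fin d)} (hW : IsBrownianSheet P d W) {p q : ℝ × ℝ}
    (hp : p ∈ Set.Icc (0 : ℝ × ℝ) 1) (hq : q ∈ Set.Icc (0 : ℝ × ℝ) 1) (i j : Fin d) :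
    cov[fun ω => W p ω i, fun ω => W q ω j; P]
      = if i = j then min p.1 q.1 * min p.2 q.2 else 0 := by
  have hvar : ∀ {p : ℝ × ℝ}, p ∈ Set.Icc (0 : ℝ × ℝ) 1 → ∀ i : Fin d,
      Var[fun ω => W p ω i; P] = p.1 * p.2 := by
    intro p hp i
    have h := hW.map_sum (ι := Unit) (fun _ => p) (fun _ => i) (fun _ => 1) fun _ => hp
    simp only [Finset.univ_unique, Finset.sum_const, Finset.card_singleton, one_smul, one_mul,
      if_true, min_self] at h
    have h0 : 0 ≤ p.1 * p.2 := mul_nonneg hp.1.1 hp.1.2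
    rw [← variance_id_map (hW.measurable_coord p i).aemeasurable, h, variance_id_gaussianReal,
      Real.coe_toNNReal _ h0]
  have h := hW.map_sum (ι := Bool) (fun b => cond b p q) (fun b => cond b i j) (fun _ => 1)
    fun b => by cases b <;> assumption
  simp only [Fintype.sum_bool, cond_true, cond_false, one_mul, if_true, min_self] at h
  have hV := variance_fun_add (hW.memLp_two hp i) (hW.memLp_two hq j)
  have h0 : 0 ≤ p.1 * p.2 := mul_nonneg hp.1.1 hp.1.2
  have h1 : 0 ≤ q.1 * q.2 := mul_nonneg hq.1.1 hq.1.2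
  have h2 : 0 ≤ min p.1 q.1 * min p.2 q.2 :=
    mul_nonneg (le_min hp.1.1 hq.1.1) (le_min hp.1.2 hq.1.2)
  have hm : Measurable fun ω => W p ω i + W q ω j :=
    (hW.measurable_coord p i).add (hW.measurable_coord q j)
  rw [hvar hp, hvar hq, ← variance_id_map hm.aemeasurable, h] at hV
  rw [variance_id_gaussianReal] at hV
  simp only [min_comm q.1, min_comm q.2, eq_comm (a := j)] at hV
  rw [Real.coe_toNNReal _ (by split_ifs <;> positivity)] at hV
  linarith

/-- The increments of the sheet in the first variable are scaled standard Gaussian vectors. -/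
lemma IsBrownianSheet.map_sub {Ω : Type*} [MeasurableSpace Ω] {P : Measure Ω}
    [IsProbabilityMeasure P] {d : ℕ} {W : ℝ × ℝ → Ω → EuclideanSpace ℝ (Fin d)}
    (hW : IsBrownianSheet P d W) {a b t : ℝ} (ha : 0 ≤ a) (hab : a ≤ b) (hb : b ≤ 1)
    (ht : 0 ≤ t) (ht1 : t ≤ 1) :
    P.map (fun ω => W (b, t) ω - W (a, t) ω)
      = (stdGaussian (EuclideanSpace ℝ (Fin d))).map (fun z => Real.sqrt (t * (b - a)) • z) := by
  have hD : Measurable fun ω => W (b, t) ω - W (a, t) ω := (hW.1 _).sub (hW.1 _)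
  have := Measure.isProbabilityMeasure_map hD.aemeasurable (μ := P)
  have hs : Measurable fun z : EuclideanSpace ℝ (Fin d) => Real.sqrt (t * (b - a)) • z := by
    fun_prop
  have := Measure.isProbabilityMeasure_map hs.aemeasurable (μ := stdGaussian (EuclideanSpace ℝ (Fin d)))
  refine Measure.ext_of_charFun (funext fun ξ => ?_)
  have h := hW.map_sum (ι := Fin d ⊕ Fin d) (Sum.elim (fun _ => (b, t)) (fun _ => (a, t)))
    (Sum.elim id id) (Sum.elim (fun x => ξ x) (fun x => -ξ x)) fun j => by
      rcases j with j | j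
      · exact ⟨⟨ha.trans hab, ht⟩, ⟨hb, ht1⟩⟩
      · exact ⟨⟨ha, ht⟩, ⟨hab.trans hb, ht1⟩⟩
  simp only [Fintype.sum_sum_type, Sum.elim_inl, Sum.elim_inr, id, min_self, min_eq_left hab,
    min_eq_right hab, mul_ite, mul_zero, Finset.sum_ite_eq, Finset.mem_univ, if_true] at h
  have hv : (∑ x, (ξ x * ξ x * (b * t) + ξ x * (-ξ x) * (a * t)) +
      ∑ x, ((-ξ x) * ξ x * (a * t) + (-ξ x) * (-ξ x) * (a * t))) = ‖ξ‖ ^ 2 * (t * (b - a)) := by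
    rw [EuclideanSpace.real_norm_sq_eq, Finset.sum_mul, ← Finset.sum_add_distrib]
    refine Finset.sum_congr rfl fun x _ => ?_
    ring
  have hc : charFun (P.map (fun ω => W (b, t) ω - W (a, t) ω)) ξ
      = charFun (gaussianReal 0 (‖ξ‖ ^ 2 * (t * (b - a))).toNNReal) 1 := by
    rw [← hv]
    simp only [Finset.sum_add_distrib] at h ⊢
    rw [← h, charFun_apply, charFun_apply, integral_map hD.aemeasurable (by fun_prop),
      integral_map]
    · refine integral_congr_ae (Eventually.of_forall fun ω => ?_)
      simp only [RCLike.inner_apply, PiLp.inner_apply]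
      simp
      congr 2
      norm_cast
      rw [← Finset.sum_neg_distrib, ← Finset.sum_add_distrib]
      refine Finset.sum_congr rfl fun x _ => ?_
      ring
    · have h1 := hW.1 (a, t)
      have h2 := hW.1 (b, t)
      fun_prop
    · fun_prop
  have h0 : 0 ≤ t * (b - a) := mul_nonneg ht (sub_nonneg.2 hab)
  rw [hc, charFun_gaussianReal, charFun_map_smul, charFun_stdGaussian,
    Real.coe_toNNReal _ (by positivity)]
  have hn : ‖Real.sqrt (t * (b - a)) • ξ‖ ^ 2 = ‖ξ‖ ^ 2 * (t * (b - a)) := by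
    rw [norm_smul, mul_pow, Real.norm_eq_abs, sq_abs, Real.sq_sqrt h0, mul_comm]
  have hn' := congrArg Complex.ofReal hn
  rw [Complex.ofReal_pow] at hn'
  rw [hn']
  push_cast
  congr 1
  ring

/-- The increments of the sheet in the first variable are independent of the past. -/
lemma IsBrownianSheet.indepFun_past {Ω : Type*} [MeasurableSpace Ω] {P : Measure Ω}
    [IsProbabilityMeasure P] {d : ℕ} {W : ℝ × ℝ → Ω → EuclideanSpace ℝ (Fin d)}
    (hW : IsBrownianSheet P d W) {t : ℝ} (ht : 0 ≤ t) (ht1 : t ≤ 1) {ι : Type*} (τ : ι → ℝ)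
    {a b : ℝ} (hτ : ∀ i, 0 ≤ τ i) (hτa : ∀ i, τ i ≤ a) (ha : 0 ≤ a) (hab : a ≤ b) (hb : b ≤ 1) :
    IndepFun (fun ω i => W (τ i, t) ω) (fun ω => W (b, t) ω - W (a, t) ω) P := by
  classical
  have hτI : ∀ i, (τ i, t) ∈ Set.Icc (0 : ℝ × ℝ) 1 := fun i =>
    ⟨⟨hτ i, ht⟩, ⟨(hτa i).trans (hab.trans hb), ht1⟩⟩
  have haI : (a, t) ∈ Set.Icc (0 : ℝ × ℝ) 1 := ⟨⟨ha, ht⟩, ⟨hab.trans hb, ht1⟩⟩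
  have hbI : (b, t) ∈ Set.Icc (0 : ℝ × ℝ) 1 := ⟨⟨ha.trans hab, ht⟩, ⟨hb, ht1⟩⟩
  let X : ι × Fin d → Ω → ℝ := fun q ω => W (τ q.1, t) ω q.2
  let Y : Fin d → Ω → ℝ := fun j ω => W (b, t) ω j - W (a, t) ω j
  have hXY : IsGaussianProcess (Sum.elim X Y) P := by
    refine hW.isGaussianProcess.of_isGaussianProcess fun q => ?_
    rcases q with q | j
    · refine ⟨{(⟨_, hτI q.1⟩, q.2)}, ContinuousLinearMap.proj ⟨_, Finset.mem_singleton_self _⟩,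
        fun ω => rfl⟩
    · refine ⟨{(⟨_, hbI⟩, j), (⟨_, haI⟩, j)},
        ContinuousLinearMap.proj ⟨(⟨_, hbI⟩, j), by simp⟩ -
          ContinuousLinearMap.proj ⟨(⟨_, haI⟩, j), by simp⟩, fun ω => rfl⟩
  have hind := hXY.indepFun_of_covariance_eq_zero
    (fun q => (hW.measurable_coord _ _).aemeasurable)
    (fun j => by
      have h1 := hW.measurable_coord (b, t) j
      have h2 := hW.measurable_coord (a, t) j
      exact (h1.sub h2).aemeasurable)
    (fun q j => by
      have := covariance_fun_sub_right (hW.memLp_two (hτI q.1) q.2) (hW.memLp_two hbI j)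
        (hW.memLp_two haI j)
      simp only [X, Y]
      rw [this, hW.covariance_eq (hτI _) hbI, hW.covariance_eq (hτI _) haI]
      simp [min_eq_left (hτa q.1), min_eq_left ((hτa q.1).trans hab)])
  have h1 : Measurable fun (x : ι × Fin d → ℝ) (i : ι) =>
      (WithLp.toLp 2 fun j => x (i, j) : EuclideanSpace ℝ (Fin d)) :=
    measurable_pi_lambda _ fun i => by fun_prop
  have h2 : Measurable fun (x : Fin d → ℝ) => (WithLp.toLp 2 x : EuclideanSpace ℝ (Fin d)) := by
    fun_prop
  exact hind.comp h1 h2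

lemma exp_neg_div_sqrt_le {μ m : ℝ} (hμ : 0 < μ) (hm : 0 ≤ m) :
    Real.exp (-(μ * (m + 1))) / Real.sqrt (m + 1) ≤ 4 / Real.sqrt μ *
      (Real.sqrt (μ * (m + 1)) / (1 + Real.sqrt (μ * (m + 1)))
        - Real.sqrt (μ * m) / (1 + Real.sqrt (μ * m))) := by
  rw [Real.sqrt_mul hμ.le, Real.sqrt_mul hμ.le]
  obtain ⟨a, ha, ha'⟩ : ∃ a, a = Real.sqrt μ ∧ 0 < a := ⟨_, rfl, Real.sqrt_pos.2 hμ⟩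
  obtain ⟨y, hy, hy0⟩ : ∃ y, y = Real.sqrt m ∧ 0 ≤ y := ⟨_, rfl, Real.sqrt_nonneg _⟩
  obtain ⟨x, hx, hx0⟩ : ∃ x, x = Real.sqrt (m + 1) ∧ 0 < x := ⟨_, rfl, Real.sqrt_pos.2 (by linarith)⟩
  have haμ : a ^ 2 = μ := by rw [ha, Real.sq_sqrt hμ.le]
  have hym : y ^ 2 = m := by rw [hy, Real.sq_sqrt hm]
  have hxm : x ^ 2 = m + 1 := by rw [hx, Real.sq_sqrt (by linarith)]
  have hyx : y ≤ x := by rw [hy, hx]; exact Real.sqrt_le_sqrt (by linarith)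
  rw [← ha, ← hx, ← hy, ← haμ, ← hxm]
  have hexp : Real.exp (-(a ^ 2 * x ^ 2)) ≤ 2 / (1 + a * x) ^ 2 := by
    rw [Real.exp_neg, inv_eq_one_div, div_le_div_iff₀ (Real.exp_pos _) (by positivity)]
    nlinarith [Real.add_one_le_exp (a ^ 2 * x ^ 2), sq_nonneg (1 - a * x)]
  have hxy : 1 / (2 * x) ≤ x - y := by
    rw [div_le_iff₀ (by positivity)]
    nlinarith
  have e : a * x / (1 + a * x) - a * y / (1 + a * y)
      = a * (x - y) / ((1 + a * x) * (1 + a * y)) := by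
    field_simp
    ring
  calc Real.exp (-(a ^ 2 * x ^ 2)) / x ≤ 2 / (1 + a * x) ^ 2 / x := by gcongr
    _ = 4 / a * (a * (1 / (2 * x)) / ((1 + a * x) * (1 + a * x))) := by field_simp; ring
    _ ≤ 4 / a * (a * (x - y) / ((1 + a * x) * (1 + a * y))) := by gcongr
    _ = _ := by rw [e]

lemma sum_exp_neg_div_sqrt_le {μ : ℝ} (hμ : 0 < μ) (k n : ℕ) :
    ∑ j ∈ Finset.Ioc k n, Real.exp (-(μ * (j - k : ℝ))) / Real.sqrt (j - k : ℝ)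
      ≤ 4 / Real.sqrt μ := by
  have main : ∀ N : ℕ, ∑ j ∈ Finset.Ioc k (k + N),
      Real.exp (-(μ * (j - k : ℝ))) / Real.sqrt (j - k : ℝ)
      ≤ 4 / Real.sqrt μ * (Real.sqrt (μ * N) / (1 + Real.sqrt (μ * N))) := by
    intro N
    induction N with
    | zero => simp
    | succ N ih =>
      rw [← add_assoc, Finset.sum_Ioc_succ_top (by omega)]
      have := exp_neg_div_sqrt_le hμ (Nat.cast_nonneg (α := ℝ) N)
      push_cast
      rw [show (k : ℝ) + N + 1 - k = N + 1 by ring]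
      linarith
  rcases le_total k n with h | h
  · obtain ⟨N, rfl⟩ := Nat.exists_eq_add_of_le h
    refine (main N).trans (mul_le_of_le_one_right (by positivity) ?_)
    rw [div_le_one (by positivity)]
    linarith
  · rw [Finset.Ioc_eq_empty (by omega), Finset.sum_empty]
    positivity

lemma mul_norm_add_smul_sq_le {E : Type*} [NormedAddCommGroup E] [NormedSpace ℝ E] {α σ : ℝ}
    (hα : 0 ≤ α) (hα1 : α ≤ 1 / 32) (hσ : 0 ≤ σ) (hσ1 : σ ≤ 1) (x z : E) :
    α * ‖x + σ • z‖ ^ 2 ≤ (α + 8 * α ^ 2 * σ ^ 2) * ‖x‖ ^ 2 + ‖z‖ ^ 2 / 4 := by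
  have h1 : ‖x + σ • z‖ ≤ ‖x‖ + σ * ‖z‖ := by
    simpa [norm_smul, abs_of_nonneg hσ] using norm_add_le x (σ • z)
  have h2 : ‖x + σ • z‖ ^ 2 ≤ (‖x‖ + σ * ‖z‖) ^ 2 := by gcongr
  have h3 : α * σ ^ 2 * ‖z‖ ^ 2 ≤ 1 / 8 * ‖z‖ ^ 2 := by
    gcongr
    nlinarith
  nlinarith [mul_le_mul_of_nonneg_left h2 hα, sq_nonneg (8 * α * σ * ‖x‖ - ‖z‖)]

/-- A supersolution of the renewal inequality satisfied by the exponential functional. -/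
def khasminskiiWeight {E : Type*} [Norm E] (n j : ℕ) (x : E) : ℝ :=
  2 * Real.exp (1 / 128 * ((n - j : ℝ) / n) + 1 / 64 * (1 + (n - j : ℝ) / n) * ‖x‖ ^ 2)

lemma khasminskiiWeight_pos {E : Type*} [Norm E] (n j : ℕ) (x : E) :
    0 < khasminskiiWeight n j x := by
  unfold khasminskiiWeight
  positivity

lemma two_le_khasminskiiWeight {E : Type*} [SeminormedAddCommGroup E] {n j : ℕ} (h : j ≤ n) (x : E) :
    2 ≤ khasminskiiWeight n j x := by
  unfold khasminskiiWeight
  have : (0 : ℝ) ≤ (n - j : ℝ) / n := div_nonneg (sub_nonneg.2 (by exact_mod_cast h)) (by positivity)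
  have := Real.one_le_exp (show 0 ≤ 1 / 128 * ((n - j : ℝ) / n)
    + 1 / 64 * (1 + (n - j : ℝ) / n) * ‖x‖ ^ 2 by positivity)
  linarith

lemma khasminskiiWeight_add_le {E : Type*} [NormedAddCommGroup E] [NormedSpace ℝ E] {n j k : ℕ}
    (hn : 0 < n) (hkj : k ≤ j) (hj : j ≤ n) {σ : ℝ} (hσ : 0 ≤ σ)
    (hσ2 : σ ^ 2 ≤ (j - k : ℝ) / n) (x z : E) :
    khasminskiiWeight n j (x + σ • z) ≤ khasminskiiWeight n k x *
      Real.exp (-((1 + ‖x‖ ^ 2) / (128 * n) * (j - k : ℝ))) * Real.exp (‖z‖ ^ 2 / 4) := by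
  unfold khasminskiiWeight
  have hn' : (0 : ℝ) < n := by exact_mod_cast hn
  have hkj' : (k : ℝ) ≤ j := by exact_mod_cast hkj
  have hj' : (j : ℝ) ≤ n := by exact_mod_cast hj
  have hk0 : (0 : ℝ) ≤ k := by positivity
  have hj1 : (n - j : ℝ) / n ≤ 1 := by rw [div_le_one hn']; linarith
  have hj0 : 0 ≤ (n - j : ℝ) / n := div_nonneg (by linarith) hn'.le
  have hjk1 : (j - k : ℝ) / n ≤ 1 := by rw [div_le_one hn']; linarith
  have hσ1 : σ ≤ 1 := by nlinarith
  rw [mul_assoc (2 * Real.exp _), ← Real.exp_add, mul_assoc 2 (Real.exp _), ← Real.exp_add]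
  refine mul_le_mul_of_nonneg_left (Real.exp_le_exp.2 ?_) two_pos.le
  have h := mul_norm_add_smul_sq_le (α := 1 / 64 * (1 + (n - j : ℝ) / n)) (by positivity)
    (by linarith) hσ hσ1 x z
  have e1 : (n - k : ℝ) / n = (n - j : ℝ) / n + (j - k : ℝ) / n := by field_simp; ring
  have e2 : (1 + ‖x‖ ^ 2) / (128 * n) * (j - k : ℝ)
      = 1 / 128 * ((j - k : ℝ) / n) * (1 + ‖x‖ ^ 2) := by field_simp
  have h3 : 8 * (1 / 64 * (1 + (n - j : ℝ) / n)) ^ 2 * σ ^ 2 ≤ 1 / 128 * ((j - k : ℝ) / n) := by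
    have : (1 / 64 * (1 + (n - j : ℝ) / n)) ^ 2 ≤ (1 / 32) ^ 2 := by
      gcongr
      linarith
    calc _ ≤ 8 * (1 / 32) ^ 2 * ((j - k : ℝ) / n) := by gcongr
      _ = _ := by ring
  have h4 := mul_le_mul_of_nonneg_right h3 (sq_nonneg ‖x‖)
  rw [e1, e2]
  linarith

lemma lintegral_diffQuot_mul_khasminskiiWeight_le {d : ℕ} {g : EuclideanSpace ℝ (Fin d) → ℝ}
    (hg : Continuous g) (hm : ∀ x y : EuclideanSpace ℝ (Fin d), (∀ i, x i ≤ y i) → g x ≤ g y)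
    {B M : ℝ} (hB : ∀ x, |g x| ≤ B) (hM : 0 < M) (hgM : ∀ x, |g x| ≤ M * (1 + ‖x‖)) (i : Fin d)
    {h ζ θ : ℝ} (hh : 0 < h) (hh1 : h ≤ 1) (hζ : 0 < ζ) (hθ : 0 < θ) (hθ1 : θ ≤ 1) {n j k : ℕ}
    (hkj : k < j) (hj : j ≤ n) (x : EuclideanSpace ℝ (Fin d)) :
    ∫⁻ z, ENNReal.ofReal (4 * ζ * Real.sqrt θ / n *
        ((g (x + Real.sqrt (θ * ((j - k : ℝ) / n)) • z + h • EuclideanSpace.single i 1)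
          - g (x + Real.sqrt (θ * ((j - k : ℝ) / n)) • z)) / h))
      * ENNReal.ofReal (khasminskiiWeight n j (x + Real.sqrt (θ * ((j - k : ℝ) / n)) • z))
      ∂stdGaussian (EuclideanSpace ℝ (Fin d))
    ≤ ENNReal.ofReal (khasminskiiWeight n k x * (64 * ζ * M * (1 + ‖x‖) / Real.sqrt n) *
        (Real.exp (-((1 + ‖x‖ ^ 2) / (128 * n) * (j - k : ℝ))) / Real.sqrt (j - k : ℝ)))
      * gaussExpMoment d := by
  have hn : 0 < n := by omega
  have hn' : (0 : ℝ) < n := by exact_mod_cast hn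
  have hkj' : (0 : ℝ) < j - k := sub_pos.2 (by exact_mod_cast hkj)
  have hjk1 : (j - k : ℝ) / n ≤ 1 := by
    rw [div_le_one hn']
    have : (j : ℝ) ≤ n := by exact_mod_cast hj
    have : (0 : ℝ) ≤ k := by positivity
    linarith
  have hjk0 : 0 < (j - k : ℝ) / n := by positivity
  obtain ⟨σ, hσ⟩ : ∃ σ, σ = Real.sqrt (θ * ((j - k : ℝ) / n)) := ⟨_, rfl⟩
  have hσ0 : 0 < σ := by rw [hσ]; positivity
  have hσsq : σ ^ 2 = θ * ((j - k : ℝ) / n) := by rw [hσ, Real.sq_sqrt (by positivity)]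
  have hσ2 : σ ^ 2 ≤ (j - k : ℝ) / n := by rw [hσsq]; exact mul_le_of_le_one_left hjk0.le hθ1
  have hσ1 : σ ≤ 1 := by nlinarith
  have hσe : σ = Real.sqrt θ * Real.sqrt (j - k : ℝ) / Real.sqrt n := by
    rw [hσ, Real.sqrt_mul hθ.le, Real.sqrt_div hkj'.le, mul_div_assoc]
  rw [← hσ]
  set e := EuclideanSpace.single i (1 : ℝ) with he
  have hmono : ∀ y, g y ≤ g (y + h • e) := fun y => hm _ _ fun l => by
    simp only [he, PiLp.add_apply, PiLp.smul_apply, smul_eq_mul]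
    have : 0 ≤ (EuclideanSpace.single i (1 : ℝ) : EuclideanSpace ℝ (Fin d)) l := by
      by_cases hl : l = i <;> simp [hl]
    have := mul_nonneg hh.le this
    linarith
  set K := khasminskiiWeight n k x * Real.exp (-((1 + ‖x‖ ^ 2) / (128 * n) * (j - k : ℝ))) with hK
  have hK0 : 0 < K := mul_pos (khasminskiiWeight_pos _ _ _) (Real.exp_pos _)
  have hβ : 0 < 4 * ζ * Real.sqrt θ / n := by positivity
  have hmain := lintegral_diffQuot_stdGaussian_le hg hm hB hM hgM i hh hh1 hσ0 hσ1 x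
  calc _ ≤ ∫⁻ z, ENNReal.ofReal (4 * ζ * Real.sqrt θ / n * K) *
        ENNReal.ofReal ((g (x + σ • z + h • e) - g (x + σ • z)) / h * Real.exp (‖z‖ ^ 2 / 4))
        ∂stdGaussian (EuclideanSpace ℝ (Fin d)) := by
        refine lintegral_mono fun z => ?_
        have hD : 0 ≤ (g (x + σ • z + h • e) - g (x + σ • z)) / h :=
          div_nonneg (sub_nonneg.2 (hmono _)) hh.le
        rw [← ENNReal.ofReal_mul (by positivity), ← ENNReal.ofReal_mul (by positivity)]
        refine ENNReal.ofReal_le_ofReal ?_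
        calc _ ≤ (4 * ζ * Real.sqrt θ / n * ((g (x + σ • z + h • e) - g (x + σ • z)) / h)) *
            (K * Real.exp (‖z‖ ^ 2 / 4)) := by
              gcongr
              exact khasminskiiWeight_add_le hn hkj.le hj hσ0.le hσ2 x z
          _ = _ := by ring
    _ = ENNReal.ofReal (4 * ζ * Real.sqrt θ / n * K) * ∫⁻ z,
        ENNReal.ofReal ((g (x + σ • z + h • e) - g (x + σ • z)) / h * Real.exp (‖z‖ ^ 2 / 4))
        ∂stdGaussian (EuclideanSpace ℝ (Fin d)) := by
        rw [lintegral_const_mul' _ _ ENNReal.ofReal_ne_top]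
    _ ≤ ENNReal.ofReal (4 * ζ * Real.sqrt θ / n * K) *
        (ENNReal.ofReal (16 * M * (1 + ‖x‖) / σ) * gaussExpMoment d) := by gcongr
    _ = _ := by
        rw [← mul_assoc, ← ENNReal.ofReal_mul (by positivity)]
        congr 2
        rw [hK, hσe]
        have h1 : Real.sqrt θ ≠ 0 := (Real.sqrt_pos.2 hθ).ne'
        have h2 : Real.sqrt (j - k : ℝ) ≠ 0 := (Real.sqrt_pos.2 hkj').ne'
        have h3 : 0 < Real.sqrt n := Real.sqrt_pos.2 hn'
        have h4 : (n : ℝ) = Real.sqrt n * Real.sqrt n := (Real.mul_self_sqrt hn'.le).symm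
        generalize Real.exp (-((1 + ‖x‖ ^ 2) / (128 * n) * (j - k : ℝ))) = Q
        generalize khasminskiiWeight n k x = R
        generalize Real.sqrt (j - k : ℝ) = S at h2 ⊢
        rw [show 4 * ζ * Real.sqrt θ / (n : ℝ) = 4 * ζ * Real.sqrt θ / (Real.sqrt n * Real.sqrt n) by
          rw [← h4]]
        field_simp
        ring

lemma one_add_norm_div_sqrt_le {y : ℝ} {n : ℕ} (hn : 0 < n) :
    (1 + y) / Real.sqrt n * (4 / Real.sqrt ((1 + y ^ 2) / (128 * n))) ≤ 64 := by
  have hn' : (0 : ℝ) < n := by exact_mod_cast hn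
  have h1 : Real.sqrt n * Real.sqrt ((1 + y ^ 2) / (128 * n)) = Real.sqrt ((1 + y ^ 2) / 128) := by
    rw [← Real.sqrt_mul hn'.le]
    congr 1
    field_simp
  have h2 : 1 + y ≤ 16 * Real.sqrt ((1 + y ^ 2) / 128) := by
    have : 16 * Real.sqrt ((1 + y ^ 2) / 128) = Real.sqrt (2 * (1 + y ^ 2)) := by
      rw [show 2 * (1 + y ^ 2) = 16 ^ 2 * ((1 + y ^ 2) / 128) by ring,
        Real.sqrt_mul (by norm_num), Real.sqrt_sq (by norm_num)]
    rw [this]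
    exact Real.le_sqrt_of_sq_le (by nlinarith [sq_nonneg (1 - y)])
  rw [div_mul_div_comm, h1, div_le_iff₀ (by positivity)]
  linarith

lemma one_add_sum_lintegral_le_khasminskiiWeight {d : ℕ} {g : ℕ → EuclideanSpace ℝ (Fin d) → ℝ}
    (hg : ∀ j, Continuous (g j))
    (hm : ∀ j, ∀ x y : EuclideanSpace ℝ (Fin d), (∀ i, x i ≤ y i) → g j x ≤ g j y)
    {B M : ℝ} (hB : ∀ j x, |g j x| ≤ B) (hM : 0 < M) (hgM : ∀ j x, |g j x| ≤ M * (1 + ‖x‖))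
    (i : Fin d) {h ζ θ : ℝ} (hh : 0 < h) (hh1 : h ≤ 1) (hζ : 0 < ζ)
    (hζ1 : 8192 * M * ζ * (gaussExpMoment d).toReal ≤ 1) (hθ : 0 < θ) (hθ1 : θ ≤ 1)
    {n k : ℕ} (hn : 0 < n) (hk : k ≤ n) (x : EuclideanSpace ℝ (Fin d)) :
    1 + ∑ j ∈ Finset.Ioc k n, ∫⁻ z, ENNReal.ofReal (4 * ζ * Real.sqrt θ / n *
        ((g j (x + Real.sqrt (θ * ((j - k : ℝ) / n)) • z + h • EuclideanSpace.single i 1)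
          - g j (x + Real.sqrt (θ * ((j - k : ℝ) / n)) • z)) / h))
      * ENNReal.ofReal (khasminskiiWeight n j (x + Real.sqrt (θ * ((j - k : ℝ) / n)) • z))
      ∂stdGaussian (EuclideanSpace ℝ (Fin d))
    ≤ ENNReal.ofReal (khasminskiiWeight n k x) := by
  have hn' : (0 : ℝ) < n := by exact_mod_cast hn
  set K := khasminskiiWeight n k x with hK
  have hK2 : 2 ≤ K := two_le_khasminskiiWeight hk x
  set μ := (1 + ‖x‖ ^ 2) / (128 * n : ℝ) with hμ
  have hμ0 : 0 < μ := by positivity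
  set q : ℕ → ℝ := fun j => Real.exp (-(μ * (j - k : ℝ))) / Real.sqrt (j - k : ℝ) with hq
  set c := K * (64 * ζ * M * (1 + ‖x‖) / Real.sqrt n) with hc
  have hc0 : 0 ≤ c := by positivity
  have hsum : ∑ j ∈ Finset.Ioc k n, q j ≤ 4 / Real.sqrt μ := sum_exp_neg_div_sqrt_le hμ0 k n
  have hJ : gaussExpMoment d = ENNReal.ofReal (gaussExpMoment d).toReal :=
    (ENNReal.ofReal_toReal (gaussExpMoment_ne_top d)).symm
  have hJ0 : 0 ≤ (gaussExpMoment d).toReal := ENNReal.toReal_nonneg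
  have hbound : c * (4 / Real.sqrt μ) * (gaussExpMoment d).toReal ≤ K / 2 := by
    have h1 := one_add_norm_div_sqrt_le (y := ‖x‖) hn
    rw [← hμ] at h1
    calc _ = K * (64 * ζ * M * (gaussExpMoment d).toReal) *
          ((1 + ‖x‖) / Real.sqrt n * (4 / Real.sqrt μ)) := by rw [hc]; ring
      _ ≤ K * (64 * ζ * M * (gaussExpMoment d).toReal) * 64 := by gcongr
      _ = K / 2 * (8192 * M * ζ * (gaussExpMoment d).toReal) := by ring
      _ ≤ K / 2 := mul_le_of_le_one_right (by positivity) hζ1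
  have hsum' : ∑ j ∈ Finset.Ioc k n, ENNReal.ofReal (c * q j) * gaussExpMoment d
      ≤ ENNReal.ofReal (K / 2) := by
    rw [← Finset.sum_mul, ← ENNReal.ofReal_sum_of_nonneg (fun j _ => by positivity),
      ← Finset.mul_sum, hJ, ← ENNReal.ofReal_mul (mul_nonneg hc0
        (Finset.sum_nonneg fun j _ => by positivity))]
    refine ENNReal.ofReal_le_ofReal (le_trans ?_ hbound)
    gcongr
  have hone : (1 : ENNReal) ≤ ENNReal.ofReal (K / 2) := by
    rw [← ENNReal.ofReal_one]
    exact ENNReal.ofReal_le_ofReal (by linarith)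
  calc _ ≤ ENNReal.ofReal (K / 2) + ENNReal.ofReal (K / 2) := by
        refine add_le_add hone (le_trans (Finset.sum_le_sum fun j hj => ?_) hsum')
        rw [Finset.mem_Ioc] at hj
        exact lintegral_diffQuot_mul_khasminskiiWeight_le (hg j) (hm j) (hB j) hM (hgM j) i hh hh1
          hζ hθ hθ1 hj.1 hj.2 x
    _ = ENNReal.ofReal K := by
        rw [← ENNReal.ofReal_add (by positivity) (by positivity), add_halves]

/-- The exponential moment bound along a line with the second time parameter frozen. -/
lemma IsBrownianSheet.lintegral_exp_sum_diffQuot_le {Ω : Type*} [MeasurableSpace Ω]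
    {P : Measure Ω} [IsProbabilityMeasure P] {d : ℕ} {W : ℝ × ℝ → Ω → EuclideanSpace ℝ (Fin d)}
    (hW : IsBrownianSheet P d W) {g : ℕ → EuclideanSpace ℝ (Fin d) → ℝ}
    (hg : ∀ j, Continuous (g j))
    (hm : ∀ j, ∀ x y : EuclideanSpace ℝ (Fin d), (∀ i, x i ≤ y i) → g j x ≤ g j y)
    {B M : ℝ} (hB : ∀ j x, |g j x| ≤ B) (hM : 0 < M) (hgM : ∀ j x, |g j x| ≤ M * (1 + ‖x‖))
    (i : Fin d) {h ζ : ℝ} (hh : 0 < h) (hh1 : h ≤ 1) (hζ : 0 < ζ)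
    (hζ1 : 8192 * M * ζ * (gaussExpMoment d).toReal ≤ 1) {r τ t : ℝ} (hr : 0 ≤ r) (hτ : 0 < τ)
    (hrτ : r + τ ≤ 1) (ht : 0 < t) (ht1 : t ≤ 1) {n : ℕ} (hn : 0 < n)
    (hnB : 4 * ζ * B / h ≤ n) :
    ∫⁻ ω, ENNReal.ofReal (Real.exp (2 * ζ * Real.sqrt (t * τ) / n * ∑ j ∈ Finset.Ioc 0 n,
        (g j (W (r + τ * (j / n), t) ω + h • EuclideanSpace.single i 1)
          - g j (W (r + τ * (j / n), t) ω)) / h)) ∂P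
      ≤ ENNReal.ofReal (2 * Real.exp 1) * gaussExpMoment d := by
  have hn' : (0 : ℝ) < n := by exact_mod_cast hn
  have hθ : 0 < t * τ := by positivity
  have hθ1 : t * τ ≤ 1 := by nlinarith
  have hsqrt : Real.sqrt (t * τ) ≤ 1 := Real.sqrt_le_one.2 hθ1
  set e : EuclideanSpace ℝ (Fin d) := EuclideanSpace.single i (1 : ℝ) with he
  let X : ℕ → Ω → EuclideanSpace ℝ (Fin d) := fun k => W (r + τ * (k / n), t)
  let D : ℕ → EuclideanSpace ℝ (Fin d) → ℝ := fun j y => (g j (y + h • e) - g j y) / h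
  let β : ℝ := 2 * ζ * Real.sqrt (t * τ) / n
  have hβ : 0 < β := by positivity
  have hD0 : ∀ j y, 0 ≤ D j y := fun j y => by
    refine div_nonneg (sub_nonneg.2 (hm j _ _ fun l => ?_)) hh.le
    have : 0 ≤ e l := by
      by_cases hl : l = i <;> simp [he, hl]
    simpa using mul_nonneg hh.le this
  have hDB : ∀ j y, D j y ≤ 2 * B / h := fun j y => by
    have h1 := abs_le.1 (hB j (y + h • e))
    have h2 := abs_le.1 (hB j y)
    simp only [D]
    gcongr
    linarith
  have hβD : ∀ j y, β * D j y ≤ 1 := fun j y => by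
    calc β * D j y ≤ 2 * ζ * 1 / n * (2 * B / h) := by
          simp only [β]
          gcongr
          · exact hD0 j y
          · exact hDB j y
      _ = (4 * ζ * B / h) / n := by ring
      _ ≤ 1 := by rwa [div_le_one hn']
  have hexp : ∀ j y, Real.exp (β * D j y) ≤ 1 + 2 * (β * D j y) := fun j y => by
    have h0 : 0 ≤ β * D j y := mul_nonneg hβ.le (hD0 j y)
    have := Real.abs_exp_sub_one_le (x := β * D j y) (by rw [abs_of_nonneg h0]; exact hβD j y)
    rw [abs_of_nonneg h0] at this
    linarith [(abs_le.1 this).2]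
  have hDm : ∀ j, Measurable (D j) := fun j => by
    have := (hg j).measurable
    have h1 : Measurable fun y => g j (y + h • e) := this.comp (measurable_add_const _)
    exact (h1.sub this).div_const h
  let b : ℕ → EuclideanSpace ℝ (Fin d) → ENNReal := fun j y =>
    ENNReal.ofReal (4 * ζ * Real.sqrt (t * τ) / n * D j y)
  let A : ℕ → EuclideanSpace ℝ (Fin d) → ENNReal := fun j y =>
    ENNReal.ofReal (khasminskiiWeight n j y)
  have hb : ∀ j, Measurable (b j) := fun j => ((hDm j).const_mul _).ennreal_ofReal
  have hA : ∀ j, Measurable (A j) := fun j => by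
    simp only [A, khasminskiiWeight]
    fun_prop
  have htime : ∀ {j k : ℕ}, k ≤ j → r + τ * ((k : ℝ) / n) ≤ r + τ * ((j : ℝ) / n) := fun hkj => by
    gcongr
  have htime1 : ∀ {j : ℕ}, j ≤ n → r + τ * ((j : ℝ) / n) ≤ 1 := fun {j} hj => by
    have : (j : ℝ) / n ≤ 1 := by rw [div_le_one hn']; exact_mod_cast hj
    nlinarith
  have htime0 : ∀ j : ℕ, 0 ≤ r + τ * ((j : ℝ) / n) := fun j => by positivity
  have hchain := lintegral_prod_one_add_le (P := P) (X := X) (fun k => hW.1 _) n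
    (fun k j hkj hj => hW.indepFun_past ht.le ht1
      (fun l : ℕ => r + τ * (((min l k : ℕ) : ℝ) / n)) (fun l => htime0 _)
      (fun l => htime (min_le_right _ _)) (htime0 k) (htime hkj.le) (htime1 hj))
    hb hA (fun k hk x => by
      have := one_add_sum_lintegral_le_khasminskiiWeight hg hm hB hM hgM i hh hh1 hζ hζ1 hθ hθ1
        hn hk x
      refine le_trans (le_of_eq ?_) this
      congr 1
      refine Finset.sum_congr rfl fun j hj => ?_
      rw [Finset.mem_Ioc] at hj
      rw [hW.map_sub (htime0 k) (htime hj.1.le) (htime1 hj.2) ht.le ht1, lintegral_map]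
      · have : t * (r + τ * ((j : ℝ) / n) - (r + τ * ((k : ℝ) / n)))
            = t * τ * ((j - k : ℝ) / n) := by ring
        rw [this]
      · exact ((hb j).comp (measurable_const_add x)).mul ((hA j).comp (measurable_const_add x))
      · fun_prop)
  calc _ ≤ ∫⁻ ω, ∏ j ∈ Finset.Ioc 0 n, (1 + b j (X j ω)) ∂P := by
        refine lintegral_mono fun ω => ?_
        rw [Finset.mul_sum, Real.exp_sum, ENNReal.ofReal_prod_of_nonneg
          (fun j _ => (Real.exp_pos _).le)]
        refine Finset.prod_le_prod' fun j _ => ?_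
        refine (ENNReal.ofReal_le_ofReal (hexp j (X j ω))).trans (le_of_eq ?_)
        rw [ENNReal.ofReal_add zero_le_one (by have := hD0 j (X j ω); positivity),
          ENNReal.ofReal_one]
        simp only [b, β]
        congr 2
        ring
    _ ≤ ∫⁻ ω, A 0 (X 0 ω) ∂P := hchain
    _ = ∫⁻ x, A 0 x ∂(P.map (fun ω => W (r, t) ω - W (0, t) ω)) := by
        have hsub : Measurable fun ω => W (r, t) ω - W (0, t) ω := (hW.1 _).sub (hW.1 _)
        rw [lintegral_map (hA 0) hsub]
        refine lintegral_congr fun ω => ?_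
        rw [hW.2.2.1 ω (0, t) ⟨⟨le_rfl, ht.le⟩, ⟨zero_le_one, ht1⟩⟩ (Or.inl rfl)]
        simp [X]
    _ = ∫⁻ z, A 0 (Real.sqrt (t * (r - 0)) • z) ∂stdGaussian (EuclideanSpace ℝ (Fin d)) := by
        rw [hW.map_sub le_rfl hr (by linarith) ht.le ht1, lintegral_map (hA 0) (by fun_prop)]
    _ ≤ ∫⁻ z, ENNReal.ofReal (2 * Real.exp 1) * ENNReal.ofReal (Real.exp (3 / 8 * ‖z‖ ^ 2))
        ∂stdGaussian (EuclideanSpace ℝ (Fin d)) := by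
        refine lintegral_mono fun z => ?_
        rw [← ENNReal.ofReal_mul (by positivity), mul_assoc, ← Real.exp_add]
        refine ENNReal.ofReal_le_ofReal ?_
        unfold khasminskiiWeight
        refine mul_le_mul_of_nonneg_left (Real.exp_le_exp.2 ?_) two_pos.le
        have h1 : ‖Real.sqrt (t * (r - 0)) • z‖ ^ 2 ≤ ‖z‖ ^ 2 := by
          rw [norm_smul, mul_pow, Real.norm_eq_abs, sq_abs, Real.sq_sqrt (by positivity)]
          exact mul_le_of_le_one_left (by positivity) (by nlinarith)
        have h2 : ((n : ℝ) - (0 : ℕ)) / n = 1 := by simp [hn'.ne']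
        rw [h2]
        nlinarith
    _ = _ := by
        rw [lintegral_const_mul' _ _ ENNReal.ofReal_ne_top, gaussExpMoment]

/-- The difference quotient of `f` in the `i`-th space direction. -/
def spaceDiffQuot {d : ℕ} (f : ℝ × ℝ → EuclideanSpace ℝ (Fin d) → ℝ) (i : Fin d) (h : ℝ)
    (p : ℝ × ℝ) (x : EuclideanSpace ℝ (Fin d)) : ℝ :=
  (f p (x + h • EuclideanSpace.single i 1) - f p x) / h

lemma spaceDiffQuot_nonneg {d : ℕ} {f : ℝ × ℝ → EuclideanSpace ℝ (Fin d) → ℝ}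
    (hm : ∀ p, ∀ x y : EuclideanSpace ℝ (Fin d), (∀ i, x i ≤ y i) → f p x ≤ f p y) (i : Fin d)
    {h : ℝ} (hh : 0 < h) (p : ℝ × ℝ) (x : EuclideanSpace ℝ (Fin d)) :
    0 ≤ spaceDiffQuot f i h p x := by
  refine div_nonneg (sub_nonneg.2 (hm p _ _ fun l => ?_)) hh.le
  have : 0 ≤ (EuclideanSpace.single i (1 : ℝ) : EuclideanSpace ℝ (Fin d)) l := by
    by_cases hl : l = i <;> simp [hl]
  simpa using mul_nonneg hh.le this

lemma sum_one_div_sqrt_le (n : ℕ) : ∑ l ∈ Finset.Ioc 0 n, 1 / Real.sqrt l ≤ 2 * Real.sqrt n := by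
  induction n with
  | zero => simp
  | succ n ih =>
    rw [Finset.sum_Ioc_succ_top (by omega)]
    have h0 : (0 : ℝ) ≤ n := by positivity
    have h1 : 0 < Real.sqrt (n + 1 : ℝ) := by positivity
    have h2 := Real.sq_sqrt h0
    have h3 : Real.sqrt (n + 1 : ℝ) ^ 2 = n + 1 := Real.sq_sqrt (by positivity)
    have h4 : 1 / Real.sqrt (n + 1 : ℝ) ≤ 2 * (Real.sqrt (n + 1 : ℝ) - Real.sqrt n) := by
      rw [div_le_iff₀ h1]
      nlinarith [sq_nonneg (Real.sqrt (n + 1 : ℝ) - Real.sqrt n)]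
    push_cast
    linarith

lemma IsBrownianSheet.lintegral_exp_doubleSum_diffQuot_le {Ω : Type*} [MeasurableSpace Ω]
    {P : Measure Ω} [IsProbabilityMeasure P] {d : ℕ} {W : ℝ × ℝ → Ω → EuclideanSpace ℝ (Fin d)}
    (hW : IsBrownianSheet P d W) {f : ℝ × ℝ → EuclideanSpace ℝ (Fin d) → ℝ}
    (hf : ∀ p, Continuous (f p))
    (hm : ∀ p, ∀ x y : EuclideanSpace ℝ (Fin d), (∀ i, x i ≤ y i) → f p x ≤ f p y)
    {B M : ℝ} (hB : ∀ p x, |f p x| ≤ B) (hM : 0 < M) (hfM : ∀ p x, |f p x| ≤ M * (1 + ‖x‖))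
    (i : Fin d) {h ζ : ℝ} (hh : 0 < h) (hh1 : h ≤ 1) (hζ : 0 < ζ)
    (hζ1 : 8192 * M * ζ * (gaussExpMoment d).toReal ≤ 1) {r τ u υ : ℝ} (hr : 0 ≤ r) (hτ : 0 < τ)
    (hrτ : r + τ ≤ 1) (hu : 0 ≤ u) (hυ : 0 < υ) (huυ : u + υ ≤ 1) {n : ℕ} (hn : 0 < n)
    (hnB : 4 * ζ * B / h ≤ n) :
    ∫⁻ ω, ENNReal.ofReal (Real.exp (ζ / (Real.sqrt τ * Real.sqrt υ) * (τ * υ / n ^ 2 *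
        ∑ l ∈ Finset.Ioc 0 n, ∑ j ∈ Finset.Ioc 0 n,
          spaceDiffQuot f i h (r + τ * (j / n), u + υ * (l / n))
            (W (r + τ * (j / n), u + υ * (l / n)) ω)))) ∂P
      ≤ ENNReal.ofReal (2 * Real.exp 1) * gaussExpMoment d := by
  have hn' : (0 : ℝ) < n := by exact_mod_cast hn
  let F : ℕ → Ω → ℝ := fun l ω => ∑ j ∈ Finset.Ioc 0 n,
    spaceDiffQuot f i h (r + τ * (j / n), u + υ * (l / n))
      (W (r + τ * (j / n), u + υ * (l / n)) ω)
  have hF0 : ∀ l ω, 0 ≤ F l ω := fun l ω =>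
    Finset.sum_nonneg fun j _ => spaceDiffQuot_nonneg hm i hh _ _
  have hFm : ∀ l, Measurable (F l) := fun l => by
    refine Finset.measurable_sum _ fun j _ => ?_
    have h1 := (hf (r + τ * (j / n), u + υ * (l / n))).measurable
    have h2 := hW.1 (r + τ * (j / n), u + υ * (l / n))
    exact ((h1.comp (h2.add_const _)).sub (h1.comp h2)).div_const h
  let S : ℝ := ∑ l ∈ Finset.Ioc 0 n, 1 / Real.sqrt l
  have hS0 : 0 < S := Finset.sum_pos (fun l hl => by
    have : (0 : ℝ) < l := by exact_mod_cast (Finset.mem_Ioc.1 hl).1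
    positivity) ⟨1, Finset.mem_Ioc.2 ⟨one_pos, hn⟩⟩
  have hS : S ≤ 2 * Real.sqrt n := sum_one_div_sqrt_le n
  let w : ℕ → ℝ := fun l => 1 / Real.sqrt l / S
  have hw0 : ∀ l, 0 ≤ w l := fun l => by positivity
  have hw1 : ∑ l ∈ Finset.Ioc 0 n, w l = 1 := by
    rw [← Finset.sum_div]
    exact div_self hS0.ne'
  let c : ℝ := ζ / (Real.sqrt τ * Real.sqrt υ) * (τ * υ / n ^ 2)
  have hc : c = ζ * (Real.sqrt τ * Real.sqrt υ) / n ^ 2 := by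
    have h1 := Real.mul_self_sqrt hτ.le
    have h2 := Real.mul_self_sqrt hυ.le
    have h3 : Real.sqrt τ ≠ 0 := (Real.sqrt_pos.2 hτ).ne'
    have h4 : Real.sqrt υ ≠ 0 := (Real.sqrt_pos.2 hυ).ne'
    have h5 : τ * υ = (Real.sqrt τ * Real.sqrt τ) * (Real.sqrt υ * Real.sqrt υ) := by rw [h1, h2]
    simp only [c, h5]
    field_simp
  have hcoef : ∀ l ∈ Finset.Ioc 0 n, S * c * Real.sqrt l
      ≤ 2 * ζ * Real.sqrt ((u + υ * (l / n)) * τ) / n := fun l _ => by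
    have h1 : Real.sqrt υ * Real.sqrt l ≤ Real.sqrt n * Real.sqrt (u + υ * (l / n)) := by
      rw [← Real.sqrt_mul hυ.le, ← Real.sqrt_mul hn'.le]
      refine Real.sqrt_le_sqrt ?_
      have : (n : ℝ) * (u + υ * (l / n)) = n * u + υ * l := by field_simp
      rw [this]
      have : 0 ≤ n * u := by positivity
      linarith
    calc S * c * Real.sqrt l
        ≤ 2 * Real.sqrt n * c * Real.sqrt l := by
          have : 0 ≤ c := by rw [hc]; positivity
          gcongr
      _ = 2 * ζ * Real.sqrt τ * Real.sqrt n / n ^ 2 * (Real.sqrt υ * Real.sqrt l) := by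
          rw [hc]; ring
      _ ≤ 2 * ζ * Real.sqrt τ * Real.sqrt n / n ^ 2 *
          (Real.sqrt n * Real.sqrt (u + υ * (l / n))) := by gcongr
      _ = 2 * ζ * Real.sqrt τ * (Real.sqrt n * Real.sqrt n) / n ^ 2 *
          Real.sqrt (u + υ * (l / n)) := by ring
      _ = _ := by
          rw [Real.mul_self_sqrt hn'.le, Real.sqrt_mul' _ hτ.le]
          field_simp
  have hjensen : ∀ ω, Real.exp (c * ∑ l ∈ Finset.Ioc 0 n, F l ω) ≤
      ∑ l ∈ Finset.Ioc 0 n, w l *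
        Real.exp (2 * ζ * Real.sqrt ((u + υ * (l / n)) * τ) / n * F l ω) := fun ω => by
    calc Real.exp (c * ∑ l ∈ Finset.Ioc 0 n, F l ω)
        = Real.exp (∑ l ∈ Finset.Ioc 0 n, w l • (S * c * Real.sqrt l * F l ω)) := by
          rw [Finset.mul_sum]
          congr 1
          refine Finset.sum_congr rfl fun l hl => ?_
          have : (0 : ℝ) < l := by exact_mod_cast (Finset.mem_Ioc.1 hl).1
          have : Real.sqrt l ≠ 0 := (Real.sqrt_pos.2 this).ne'
          simp only [w, smul_eq_mul]
          field_simp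
      _ ≤ ∑ l ∈ Finset.Ioc 0 n, w l • Real.exp (S * c * Real.sqrt l * F l ω) :=
          convexOn_exp.map_sum_le (fun l _ => hw0 l) hw1 fun _ _ => Set.mem_univ _
      _ ≤ _ := by
          refine Finset.sum_le_sum fun l hl => ?_
          rw [smul_eq_mul]
          have := mul_le_mul_of_nonneg_right (hcoef l hl) (hF0 l ω)
          have := hw0 l
          gcongr
  calc _ ≤ ∫⁻ ω, ∑ l ∈ Finset.Ioc 0 n, ENNReal.ofReal (w l) * ENNReal.ofReal
        (Real.exp (2 * ζ * Real.sqrt ((u + υ * (l / n)) * τ) / n * F l ω)) ∂P := by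
        refine lintegral_mono fun ω => ?_
        rw [← mul_assoc]
        refine (ENNReal.ofReal_le_ofReal (hjensen ω)).trans (le_of_eq ?_)
        rw [ENNReal.ofReal_sum_of_nonneg fun l _ => mul_nonneg (hw0 l) (Real.exp_pos _).le]
        exact Finset.sum_congr rfl fun l _ => ENNReal.ofReal_mul (hw0 l)
    _ = ∑ l ∈ Finset.Ioc 0 n, ENNReal.ofReal (w l) * ∫⁻ ω, ENNReal.ofReal
        (Real.exp (2 * ζ * Real.sqrt ((u + υ * (l / n)) * τ) / n * F l ω)) ∂P := by
        rw [lintegral_finsetSum]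
        · exact Finset.sum_congr rfl fun l _ => lintegral_const_mul' _ _ ENNReal.ofReal_ne_top
        · intro l _
          have := hFm l
          fun_prop
    _ ≤ ∑ l ∈ Finset.Ioc 0 n, ENNReal.ofReal (w l) *
        (ENNReal.ofReal (2 * Real.exp 1) * gaussExpMoment d) := by
        refine Finset.sum_le_sum fun l hl => ?_
        gcongr
        have hl0 : (0 : ℝ) < l := by exact_mod_cast (Finset.mem_Ioc.1 hl).1
        have hl1 : (l : ℝ) / n ≤ 1 := by
          rw [div_le_one hn']; exact_mod_cast (Finset.mem_Ioc.1 hl).2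
        exact hW.lintegral_exp_sum_diffQuot_le (g := fun j => f (r + τ * (j / n), u + υ * (l / n)))
          (fun j => hf _) (fun j => hm _) (fun j => hB _) hM (fun j => hfM _) i hh hh1 hζ hζ1 hr hτ
          hrτ (by positivity) (by nlinarith) hn hnB
    _ = _ := by
        rw [← Finset.sum_mul, ← ENNReal.ofReal_sum_of_nonneg fun l _ => hw0 l, hw1,
          ENNReal.ofReal_one, one_mul]

lemma abs_riemannSum_sub_integral_le {φ : ℝ → ℝ} (hφ : Continuous φ) {a τ ε : ℝ} (hτ : 0 ≤ τ)
    {n : ℕ} (hn : 0 < n)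
    (h : ∀ x ∈ Set.Icc a (a + τ), ∀ y ∈ Set.Icc a (a + τ), |x - y| ≤ τ / n → |φ x - φ y| ≤ ε) :
    |τ / n * ∑ j ∈ Finset.Ioc 0 n, φ (a + τ * (j / n)) - ∫ x in a..a + τ, φ x| ≤ ε * τ := by
  have hn' : (0 : ℝ) < n := by exact_mod_cast hn
  let x : ℕ → ℝ := fun j => a + τ * (j / n)
  have hx : ∀ j, x (j + 1) - x j = τ / n := fun j => by
    simp only [x]; push_cast; field_simp; ring
  have hmem : ∀ j ≤ n, x j ∈ Set.Icc a (a + τ) := fun j hj => by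
    have h1 : (j : ℝ) / n ≤ 1 := by rw [div_le_one hn']; exact_mod_cast hj
    have h2 : 0 ≤ (j : ℝ) / n := by positivity
    exact ⟨by simp only [x]; nlinarith, by simp only [x]; nlinarith⟩
  have hint : ∫ y in a..a + τ, φ y = ∑ j ∈ Finset.range n, ∫ y in x j..x (j + 1), φ y := by
    rw [intervalIntegral.sum_integral_adjacent_intervals
      (fun j _ => hφ.intervalIntegrable _ _)]
    simp [x, hn'.ne']
  have hsum : τ / n * ∑ j ∈ Finset.Ioc 0 n, φ (a + τ * (j / n))
      = ∑ j ∈ Finset.range n, ∫ y in x j..x (j + 1), φ (x (j + 1)) := by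
    have : Finset.Ioc 0 n = (Finset.range n).map (addRightEmbedding 1) := by
      rw [Finset.range_eq_Ico, Finset.map_add_right_Ico]
      ext j; simp; omega
    rw [this, Finset.sum_map, Finset.mul_sum]
    refine Finset.sum_congr rfl fun j _ => ?_
    rw [intervalIntegral.integral_const, hx, smul_eq_mul]
    rfl
  rw [hint, hsum, ← Finset.sum_sub_distrib]
  refine (Finset.abs_sum_le_sum_abs _ _).trans ?_
  calc _ ≤ ∑ j ∈ Finset.range n, ε * (τ / n) := by
        refine Finset.sum_le_sum fun j hj => ?_
        rw [Finset.mem_range] at hj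
        rw [← intervalIntegral.integral_sub intervalIntegrable_const
          (hφ.intervalIntegrable _ _)]
        have hle : x j ≤ x (j + 1) := by have := hx j; have : 0 ≤ τ / n := by positivity
                                         linarith
        have := intervalIntegral.norm_integral_le_of_norm_le_const (a := x j) (b := x (j + 1))
          (f := fun y => φ (x (j + 1)) - φ y) (C := ε) fun y hy => by
            rw [Set.uIoc_of_le hle] at hy
            refine h _ (hmem _ hj) _ ⟨(hmem _ hj.le).1.trans hy.1.le, hy.2.trans (hmem _ hj).2⟩ ?_
            rw [← hx j, abs_of_nonneg (sub_nonneg.2 hy.2)]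
            linarith [hy.1]
        rwa [hx, abs_of_nonneg (by positivity), Real.norm_eq_abs] at this
    _ = ε * τ := by
        rw [Finset.sum_const, Finset.card_range, nsmul_eq_mul]
        field_simp

lemma tendsto_riemannSum_prod {G : ℝ × ℝ → ℝ} (hG : Continuous G) {r τ u υ : ℝ} (hτ : 0 ≤ τ)
    (hυ : 0 ≤ υ) :
    Tendsto (fun n : ℕ => τ * υ / (n : ℝ) ^ 2 * ∑ l ∈ Finset.Ioc 0 n, ∑ j ∈ Finset.Ioc 0 n,
        G (r + τ * (j / n), u + υ * (l / n)))
      atTop (nhds (∫ s in r..r + τ, ∫ t in u..u + υ, G (s, t))) := by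
  rw [Metric.tendsto_atTop]
  intro ε hε
  have huc := (isCompact_Icc (a := ((r, u) : ℝ × ℝ)) (b := (r + τ, u + υ))).uniformContinuousOn_of_continuous
    hG.continuousOn
  rw [Metric.uniformContinuousOn_iff] at huc
  set η := ε / (2 * (τ * υ) + 1) with hη
  have hη0 : 0 < η := by positivity
  obtain ⟨δ, hδ, hδ'⟩ := huc η hη0
  obtain ⟨N, hN⟩ := exists_nat_gt ((τ + υ) / δ)
  refine ⟨N + 1, fun n hn => ?_⟩
  have hn0 : 0 < n := by omega
  have hn' : (0 : ℝ) < n := by exact_mod_cast hn0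
  have hNn : (N : ℝ) ≤ n := by exact_mod_cast (by omega : N ≤ n)
  have hsmall : (τ + υ) / n < δ := by
    rw [div_lt_iff₀ hn']
    rw [div_lt_iff₀ hδ] at hN
    nlinarith
  have hτn : τ / n < δ := lt_of_le_of_lt (by gcongr; linarith) hsmall
  have hυn : υ / n < δ := lt_of_le_of_lt (by gcongr; linarith) hsmall
  have hmodt : ∀ s ∈ Set.Icc r (r + τ), ∀ x ∈ Set.Icc u (u + υ), ∀ y ∈ Set.Icc u (u + υ),
      |x - y| ≤ υ / n → |G (s, x) - G (s, y)| ≤ η := fun s hs x hx y hy hxy => by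
    have := hδ' (s, x) ⟨⟨hs.1, hx.1⟩, ⟨hs.2, hx.2⟩⟩ (s, y) ⟨⟨hs.1, hy.1⟩, ⟨hs.2, hy.2⟩⟩
      (by rw [Prod.dist_eq, dist_self, Real.dist_eq]; exact max_lt hδ (hxy.trans_lt hυn))
    exact this.le
  have hmods : ∀ t ∈ Set.Icc u (u + υ), ∀ x ∈ Set.Icc r (r + τ), ∀ y ∈ Set.Icc r (r + τ),
      |x - y| ≤ τ / n → |G (x, t) - G (y, t)| ≤ η := fun t ht x hx y hy hxy => by
    have := hδ' (x, t) ⟨⟨hx.1, ht.1⟩, ⟨hx.2, ht.2⟩⟩ (y, t) ⟨⟨hy.1, ht.1⟩, ⟨hy.2, ht.2⟩⟩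
      (by rw [Prod.dist_eq, dist_self, Real.dist_eq]; exact max_lt (hxy.trans_lt hτn) hδ)
    exact this.le
  let Φ : ℝ → ℝ := fun s => ∫ t in u..u + υ, G (s, t)
  have hGs : ∀ s, Continuous fun t => G (s, t) := fun s => by fun_prop
  have hΦ : Continuous Φ :=
    intervalIntegral.continuous_parametric_intervalIntegral_of_continuous'
      (f := fun s t => G (s, t)) hG _ _
  have hΦmod : ∀ x ∈ Set.Icc r (r + τ), ∀ y ∈ Set.Icc r (r + τ),
      |x - y| ≤ τ / n → |Φ x - Φ y| ≤ η * υ := fun x hx y hy hxy => by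
    simp only [Φ]
    rw [← intervalIntegral.integral_sub ((hGs x).intervalIntegrable _ _)
      ((hGs y).intervalIntegrable _ _)]
    have := intervalIntegral.norm_integral_le_of_norm_le_const (a := u) (b := u + υ)
      (f := fun t => G (x, t) - G (y, t)) (C := η) fun t ht => by
        rw [Set.uIoc_of_le (by linarith)] at ht
        exact hmods t ⟨ht.1.le, ht.2⟩ x hx y hy hxy
    rwa [add_sub_cancel_left, abs_of_nonneg hυ, Real.norm_eq_abs] at this
  have h1 := abs_riemannSum_sub_integral_le hΦ hτ hn0 hΦmod
  have h2 : |τ / n * ∑ j ∈ Finset.Ioc 0 n, (υ / n * ∑ l ∈ Finset.Ioc 0 n,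
      G (r + τ * (j / n), u + υ * (l / n)) - Φ (r + τ * (j / n)))| ≤ η * υ * τ := by
    rw [abs_mul, abs_of_nonneg (by positivity)]
    calc _ ≤ τ / n * ∑ j ∈ Finset.Ioc 0 n, η * υ := by
          gcongr
          refine (Finset.abs_sum_le_sum_abs _ _).trans (Finset.sum_le_sum fun j hj => ?_)
          have hj1 : (j : ℝ) / n ≤ 1 := by
            rw [div_le_one hn']; exact_mod_cast (Finset.mem_Ioc.1 hj).2
          have hj0 : 0 ≤ (j : ℝ) / n := by positivity
          exact abs_riemannSum_sub_integral_le (hGs _) hυ hn0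
            (hmodt _ ⟨by nlinarith, by nlinarith⟩)
      _ = η * υ * τ := by
          rw [Finset.sum_const, Nat.card_Ioc, nsmul_eq_mul, Nat.sub_zero]
          field_simp
  have hsplit : τ * υ / (n : ℝ) ^ 2 * ∑ l ∈ Finset.Ioc 0 n, ∑ j ∈ Finset.Ioc 0 n,
        G (r + τ * (j / n), u + υ * (l / n)) - ∫ s in r..r + τ, Φ s
      = τ / n * ∑ j ∈ Finset.Ioc 0 n, (υ / n * ∑ l ∈ Finset.Ioc 0 n,
        G (r + τ * (j / n), u + υ * (l / n)) - Φ (r + τ * (j / n)))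
        + (τ / n * ∑ j ∈ Finset.Ioc 0 n, Φ (r + τ * (j / n)) - ∫ s in r..r + τ, Φ s) := by
    rw [Finset.sum_sub_distrib, ← Finset.mul_sum, Finset.sum_comm]
    field_simp
    ring
  rw [Real.dist_eq, hsplit]
  refine lt_of_le_of_lt (abs_add_le _ _) (lt_of_le_of_lt (add_le_add h2 h1) ?_)
  have : η * (2 * (τ * υ) + 1) = ε := by rw [hη]; field_simp
  nlinarith

/-- The projection of the plane onto the unit square. -/
def clampUnitSquare (p : ℝ × ℝ) : ℝ × ℝ := (max 0 (min 1 p.1), max 0 (min 1 p.2))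

lemma continuous_clampUnitSquare : Continuous clampUnitSquare := by
  unfold clampUnitSquare
  fun_prop

lemma clampUnitSquare_mem (p : ℝ × ℝ) : clampUnitSquare p ∈ Set.Icc (0 : ℝ × ℝ) 1 :=
  ⟨⟨le_max_left _ _, le_max_left _ _⟩,
    ⟨max_le zero_le_one (min_le_left _ _), max_le zero_le_one (min_le_left _ _)⟩⟩

lemma clampUnitSquare_eq_self {p : ℝ × ℝ} (hp : p ∈ Set.Icc (0 : ℝ × ℝ) 1) :
    clampUnitSquare p = p := by
  have h1 : p.1 ≤ 1 := hp.2.1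
  have h2 : p.2 ≤ 1 := hp.2.2
  have h3 : 0 ≤ p.1 := hp.1.1
  have h4 : 0 ≤ p.2 := hp.1.2
  simp [clampUnitSquare, h1, h2, h3, h4]

lemma continuous_spaceDiffQuot_clampUnitSquare {d : ℕ}
    {f : ℝ × ℝ → EuclideanSpace ℝ (Fin d) → ℝ}
    (hfc : ContinuousOn (fun q : (ℝ × ℝ) × EuclideanSpace ℝ (Fin d) => f q.1 q.2)
      (Set.Icc (0 : ℝ × ℝ) 1 ×ˢ Set.univ)) {w : ℝ × ℝ → EuclideanSpace ℝ (Fin d)}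
    (hw : ContinuousOn w (Set.Icc (0 : ℝ × ℝ) 1)) (i : Fin d) (h : ℝ) :
    Continuous fun p => spaceDiffQuot f i h (clampUnitSquare p) (w (clampUnitSquare p)) := by
  have hw' : Continuous fun p => w (clampUnitSquare p) :=
    hw.comp_continuous continuous_clampUnitSquare clampUnitSquare_mem
  have key : ∀ v : ℝ × ℝ → EuclideanSpace ℝ (Fin d), Continuous v →
      Continuous fun p => f (clampUnitSquare p) (v p) := fun v hv =>
    hfc.comp_continuous (continuous_clampUnitSquare.prodMk hv)
      fun p => ⟨clampUnitSquare_mem p, Set.mem_univ _⟩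
  exact ((key _ (hw'.add continuous_const)).sub (key _ hw')).div_const h

lemma IsBrownianSheet.measurable_integral_spaceDiffQuot {Ω : Type*} [MeasurableSpace Ω]
    {P : Measure Ω} {d : ℕ} {W : ℝ × ℝ → Ω → EuclideanSpace ℝ (Fin d)}
    (hW : IsBrownianSheet P d W) {f : ℝ × ℝ → EuclideanSpace ℝ (Fin d) → ℝ}
    (hfc : ContinuousOn (fun q : (ℝ × ℝ) × EuclideanSpace ℝ (Fin d) => f q.1 q.2)
      (Set.Icc (0 : ℝ × ℝ) 1 ×ˢ Set.univ)) (hf : ∀ p, Continuous (f p)) (i : Fin d) (h : ℝ)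
    {r τ u υ : ℝ} (hτ : 0 ≤ τ) (hυ : 0 ≤ υ) :
    Measurable fun ω => ∫ s in r..r + τ, ∫ t in u..u + υ,
      spaceDiffQuot f i h (clampUnitSquare (s, t)) (W (clampUnitSquare (s, t)) ω) := by
  refine measurable_of_tendsto_metrizable (f := fun (n : ℕ) ω =>
    τ * υ / (n : ℝ) ^ 2 * ∑ l ∈ Finset.Ioc 0 n, ∑ j ∈ Finset.Ioc 0 n,
      spaceDiffQuot f i h (clampUnitSquare (r + τ * (j / n), u + υ * (l / n)))
        (W (clampUnitSquare (r + τ * (j / n), u + υ * (l / n))) ω)) (fun n => ?_)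
    (tendsto_pi_nhds.2 fun ω => tendsto_riemannSum_prod
      (continuous_spaceDiffQuot_clampUnitSquare hfc (hW.2.1 ω) i h) hτ hυ)
  refine Measurable.const_mul (Finset.measurable_sum _ fun l _ =>
    Finset.measurable_sum _ fun j _ => ?_) _
  have h1 := (hf (clampUnitSquare (r + τ * (j / n), u + υ * (l / n)))).measurable
  have h2 := hW.1 (clampUnitSquare (r + τ * (j / n), u + υ * (l / n)))
  exact ((h1.comp (h2.add_const _)).sub (h1.comp h2)).div_const h

lemma IsBrownianSheet.lintegral_exp_integral_spaceDiffQuot_le {Ω : Type*} [MeasurableSpace Ω]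
    {P : Measure Ω} [IsProbabilityMeasure P] {d : ℕ} {W : ℝ × ℝ → Ω → EuclideanSpace ℝ (Fin d)}
    (hW : IsBrownianSheet P d W) {f : ℝ × ℝ → EuclideanSpace ℝ (Fin d) → ℝ}
    (hfc : ContinuousOn (fun q : (ℝ × ℝ) × EuclideanSpace ℝ (Fin d) => f q.1 q.2)
      (Set.Icc (0 : ℝ × ℝ) 1 ×ˢ Set.univ)) (hf : ∀ p, Continuous (f p))
    (hm : ∀ p, ∀ x y : EuclideanSpace ℝ (Fin d), (∀ i, x i ≤ y i) → f p x ≤ f p y)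
    {B M : ℝ} (hB : ∀ p x, |f p x| ≤ B) (hM : 0 < M) (hfM : ∀ p x, |f p x| ≤ M * (1 + ‖x‖))
    (i : Fin d) {h ζ : ℝ} (hh : 0 < h) (hh1 : h ≤ 1) (hζ : 0 < ζ)
    (hζ1 : 8192 * M * ζ * (gaussExpMoment d).toReal ≤ 1) {r τ u υ : ℝ} (hr : 0 ≤ r) (hτ : 0 < τ)
    (hrτ : r + τ ≤ 1) (hu : 0 ≤ u) (hυ : 0 < υ) (huυ : u + υ ≤ 1) :
    ∫⁻ ω, ENNReal.ofReal (Real.exp (ζ / (Real.sqrt τ * Real.sqrt υ) *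
        ∫ s in r..r + τ, ∫ t in u..u + υ,
          spaceDiffQuot f i h (clampUnitSquare (s, t)) (W (clampUnitSquare (s, t)) ω))) ∂P
      ≤ ENNReal.ofReal (2 * Real.exp 1) * gaussExpMoment d := by
  let R : ℕ → Ω → ℝ := fun n ω =>
    τ * υ / (n : ℝ) ^ 2 * ∑ l ∈ Finset.Ioc 0 n, ∑ j ∈ Finset.Ioc 0 n,
      spaceDiffQuot f i h (clampUnitSquare (r + τ * (j / n), u + υ * (l / n)))
        (W (clampUnitSquare (r + τ * (j / n), u + υ * (l / n))) ω)
  have hRm : ∀ n, Measurable (R n) := fun n => by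
    refine Measurable.const_mul (Finset.measurable_sum _ fun l _ =>
      Finset.measurable_sum _ fun j _ => ?_) _
    have h1 := (hf (clampUnitSquare (r + τ * (j / n), u + υ * (l / n)))).measurable
    have h2 := hW.1 (clampUnitSquare (r + τ * (j / n), u + υ * (l / n)))
    exact ((h1.comp (h2.add_const _)).sub (h1.comp h2)).div_const h
  have hlim : ∀ ω, Tendsto (fun n => ENNReal.ofReal (Real.exp
      (ζ / (Real.sqrt τ * Real.sqrt υ) * R n ω))) atTop
      (nhds (ENNReal.ofReal (Real.exp (ζ / (Real.sqrt τ * Real.sqrt υ) *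
        ∫ s in r..r + τ, ∫ t in u..u + υ,
          spaceDiffQuot f i h (clampUnitSquare (s, t)) (W (clampUnitSquare (s, t)) ω))))) :=
    fun ω => ENNReal.tendsto_ofReal <| (Real.continuous_exp.tendsto _).comp <|
      (tendsto_riemannSum_prod (continuous_spaceDiffQuot_clampUnitSquare hfc (hW.2.1 ω) i h)
        hτ.le hυ.le).const_mul _
  calc _ = ∫⁻ ω, liminf (fun n => ENNReal.ofReal (Real.exp
        (ζ / (Real.sqrt τ * Real.sqrt υ) * R n ω))) atTop ∂P :=
        lintegral_congr fun ω => (hlim ω).liminf_eq.symm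
    _ ≤ liminf (fun n => ∫⁻ ω, ENNReal.ofReal (Real.exp
        (ζ / (Real.sqrt τ * Real.sqrt υ) * R n ω)) ∂P) atTop :=
        lintegral_liminf_le fun n => by
          have := hRm n
          fun_prop
    _ ≤ _ := by
        refine liminf_le_of_frequently_le' (Eventually.frequently ?_)
        filter_upwards [eventually_gt_atTop 0,
          tendsto_natCast_atTop_atTop.eventually_ge_atTop (4 * ζ * B / h)] with n hn hnB
        have hn' : (0 : ℝ) < n := by exact_mod_cast hn
        have hmem : ∀ l ∈ Finset.Ioc 0 n, ∀ j ∈ Finset.Ioc 0 n,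
            (r + τ * ((j : ℝ) / n), u + υ * ((l : ℝ) / n)) ∈ Set.Icc (0 : ℝ × ℝ) 1 := by
          intro l hl j hj
          have hl1 : (l : ℝ) / n ≤ 1 := by
            rw [div_le_one hn']; exact_mod_cast (Finset.mem_Ioc.1 hl).2
          have hj1 : (j : ℝ) / n ≤ 1 := by
            rw [div_le_one hn']; exact_mod_cast (Finset.mem_Ioc.1 hj).2
          refine ⟨⟨?_, ?_⟩, ⟨?_, ?_⟩⟩
          · simp only [Prod.fst_zero]; positivity
          · simp only [Prod.snd_zero]; positivity
          · simp only [Prod.fst_one]; nlinarith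
          · simp only [Prod.snd_one]; nlinarith
        refine le_trans (le_of_eq ?_) (hW.lintegral_exp_doubleSum_diffQuot_le hf hm hB hM hfM i hh
          hh1 hζ hζ1 hr hτ hrτ hu hυ huυ hn hnB)
        refine lintegral_congr fun ω => ?_
        simp only [R]
        congr 4
        refine Finset.sum_congr rfl fun l hl => Finset.sum_congr rfl fun j hj => ?_
        rw [clampUnitSquare_eq_self (hmem l hl j hj)]

lemma ofReal_integral_integral_le_liminf {φ : ℕ → ℝ × ℝ → ℝ} (hφ : ∀ n, Continuous (φ n))
    (hφ0 : ∀ n p, 0 ≤ φ n p) {ψ : ℝ × ℝ → ℝ} {r s u t : ℝ} (hrs : r ≤ s) (hut : u ≤ t)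
    (hlim : ∀ x ∈ Set.Ioc r s, ∀ y ∈ Set.Ioc u t,
      Tendsto (fun n => φ n (x, y)) atTop (nhds (ψ (x, y)))) :
    ENNReal.ofReal (∫ x in r..s, ∫ y in u..t, ψ (x, y)) ≤
      liminf (fun n => ENNReal.ofReal (∫ x in r..s, ∫ y in u..t, φ n (x, y))) atTop := by
  have hmeas : ∀ n x, Measurable fun y => ENNReal.ofReal (φ n (x, y)) := fun n x =>
    ENNReal.measurable_ofReal.comp ((hφ n).comp (by fun_prop)).measurable
  have hmeas' : ∀ n, Measurable fun x => ∫⁻ y in Set.Ioc u t, ENNReal.ofReal (φ n (x, y)) :=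
    fun n => Measurable.lintegral_prod_right'
      (ENNReal.measurable_ofReal.comp (hφ n).measurable)
  have hφint : ∀ n, ENNReal.ofReal (∫ x in r..s, ∫ y in u..t, φ n (x, y)) =
      ∫⁻ x in Set.Ioc r s, ∫⁻ y in Set.Ioc u t, ENNReal.ofReal (φ n (x, y)) := fun n => by
    have hc : Continuous fun x => ∫ y in u..t, φ n (x, y) :=
      intervalIntegral.continuous_parametric_intervalIntegral_of_continuous'
        (f := fun x y => φ n (x, y)) (hφ n) _ _
    have h0 : ∀ x, 0 ≤ ∫ y in u..t, φ n (x, y) := fun x =>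
      intervalIntegral.integral_nonneg hut fun y _ => hφ0 n _
    rw [intervalIntegral.integral_of_le hrs, ofReal_integral_eq_lintegral_ofReal
      hc.integrableOn_Ioc (ae_of_all _ h0)]
    refine lintegral_congr fun x => ?_
    have hcx : Continuous fun y => φ n (x, y) := (hφ n).comp (by fun_prop)
    rw [intervalIntegral.integral_of_le hut, ofReal_integral_eq_lintegral_ofReal
      hcx.integrableOn_Ioc (ae_of_all _ fun y => hφ0 n _)]
  have hψ : ∀ x ∈ Set.Ioc r s, ∀ y ∈ Set.Ioc u t, ‖ψ (x, y)‖ₑ =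
      liminf (fun n => ENNReal.ofReal (φ n (x, y))) atTop := fun x hx y hy => by
    have h0 : 0 ≤ ψ (x, y) := ge_of_tendsto' (hlim x hx y hy) fun n => hφ0 n _
    rw [Real.enorm_of_nonneg h0, (ENNReal.tendsto_ofReal (hlim x hx y hy)).liminf_eq]
  calc ENNReal.ofReal (∫ x in r..s, ∫ y in u..t, ψ (x, y))
      ≤ ‖∫ x in Set.Ioc r s, ∫ y in u..t, ψ (x, y)‖ₑ := by
        rw [intervalIntegral.integral_of_le hrs]
        exact Real.ofReal_le_enorm _
    _ ≤ ∫⁻ x in Set.Ioc r s, ‖∫ y in u..t, ψ (x, y)‖ₑ := enorm_integral_le_lintegral_enorm _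
    _ ≤ ∫⁻ x in Set.Ioc r s, ∫⁻ y in Set.Ioc u t, ‖ψ (x, y)‖ₑ := by
        refine lintegral_mono fun x => ?_
        rw [intervalIntegral.integral_of_le hut]
        exact enorm_integral_le_lintegral_enorm _
    _ = ∫⁻ x in Set.Ioc r s, ∫⁻ y in Set.Ioc u t,
          liminf (fun n => ENNReal.ofReal (φ n (x, y))) atTop :=
        setLIntegral_congr_fun measurableSet_Ioc fun x hx =>
          setLIntegral_congr_fun measurableSet_Ioc fun y hy => hψ x hx y hy
    _ ≤ ∫⁻ x in Set.Ioc r s, liminf (fun n =>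
          ∫⁻ y in Set.Ioc u t, ENNReal.ofReal (φ n (x, y))) atTop :=
        lintegral_mono fun x => lintegral_liminf_le fun n => hmeas n x
    _ ≤ liminf (fun n => ∫⁻ x in Set.Ioc r s,
          ∫⁻ y in Set.Ioc u t, ENNReal.ofReal (φ n (x, y))) atTop :=
        lintegral_liminf_le hmeas'
    _ = _ := by simp_rw [hφint]

lemma ofReal_exp_le_liminf {c I : ℝ} (hc : 0 ≤ c) {J : ℕ → ℝ} (hJ : ∀ n, 0 ≤ J n)
    (hI : ENNReal.ofReal I ≤ liminf (fun n => ENNReal.ofReal (J n)) atTop) :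
    ENNReal.ofReal (Real.exp (c * I)) ≤
      liminf (fun n => ENNReal.ofReal (Real.exp (c * J n))) atTop := by
  have hcont : Tendsto (fun a => ENNReal.ofReal (Real.exp (c * a))) (nhdsWithin I (Set.Iio I))
      (nhds (ENNReal.ofReal (Real.exp (c * I)))) :=
    Tendsto.mono_left (ENNReal.tendsto_ofReal
      (Continuous.tendsto (f := fun a => Real.exp (c * a)) (by fun_prop) I)) nhdsWithin_le_nhds
  refine le_of_tendsto hcont ?_
  filter_upwards [self_mem_nhdsWithin] with a ha
  have hev : ∀ᶠ n in atTop, a ≤ J n := by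
    rcases lt_or_ge a 0 with h | h
    · exact Eventually.of_forall fun n => h.le.trans (hJ n)
    · have hlt : ENNReal.ofReal a < liminf (fun n => ENNReal.ofReal (J n)) atTop :=
        lt_of_lt_of_le ((ENNReal.ofReal_lt_ofReal_iff_of_nonneg h).2 ha) hI
      filter_upwards [eventually_lt_of_lt_liminf hlt] with n hn
      exact ((ENNReal.ofReal_lt_ofReal_iff_of_nonneg h).1 hn).le
  refine le_liminf_of_le (by isBoundedDefault) ?_
  filter_upwards [hev] with n hn
  exact ENNReal.ofReal_le_ofReal (Real.exp_le_exp.2 (mul_le_mul_of_nonneg_left hn hc))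

lemma tendsto_spaceDiffQuot {d : ℕ} {f : ℝ × ℝ → EuclideanSpace ℝ (Fin d) → ℝ} {p : ℝ × ℝ}
    (hf : Differentiable ℝ (f p)) (i : Fin d) (x : EuclideanSpace ℝ (Fin d)) :
    Tendsto (fun n : ℕ => spaceDiffQuot f i (1 / ((n : ℝ) + 1)) p x) atTop
      (nhds (fderiv ℝ (f p) x (EuclideanSpace.single i 1))) := by
  have h := ((hf x).hasFDerivAt.hasLineDerivAt (EuclideanSpace.single i 1)).tendsto_slope_zero
  have h0 : Tendsto (fun n : ℕ => 1 / ((n : ℝ) + 1)) atTop (nhdsWithin 0 {0}ᶜ) :=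
    tendsto_nhdsWithin_iff.2 ⟨tendsto_one_div_add_atTop_nhds_zero_nat,
      Eventually.of_forall fun n => (Nat.one_div_pos_of_nat).ne'⟩
  refine (h.comp h0).congr fun n => ?_
  simp [spaceDiffQuot, smul_eq_mul, div_eq_inv_mul]

lemma IsBrownianSheet.lintegral_exp_integral_fderiv_le {Ω : Type*} [MeasurableSpace Ω]
    {P : Measure Ω} [IsProbabilityMeasure P] {d : ℕ} {W : ℝ × ℝ → Ω → EuclideanSpace ℝ (Fin d)}
    (hW : IsBrownianSheet P d W) {f : ℝ × ℝ → EuclideanSpace ℝ (Fin d) → ℝ}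
    (hfc : ContinuousOn (fun q : (ℝ × ℝ) × EuclideanSpace ℝ (Fin d) => f q.1 q.2)
      (Set.Icc (0 : ℝ × ℝ) 1 ×ˢ Set.univ)) (hf : ∀ p, Differentiable ℝ (f p))
    (hm : ∀ p, ∀ x y : EuclideanSpace ℝ (Fin d), (∀ i, x i ≤ y i) → f p x ≤ f p y)
    {B M : ℝ} (hB : ∀ p x, |f p x| ≤ B) (hM : 0 < M) (hfM : ∀ p x, |f p x| ≤ M * (1 + ‖x‖))
    (i : Fin d) {ζ : ℝ} (hζ : 0 < ζ)
    (hζ1 : 8192 * M * ζ * (gaussExpMoment d).toReal ≤ 1) {r τ u υ : ℝ} (hr : 0 ≤ r) (hτ : 0 < τ)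
    (hrτ : r + τ ≤ 1) (hu : 0 ≤ u) (hυ : 0 < υ) (huυ : u + υ ≤ 1) :
    ∫⁻ ω, ENNReal.ofReal (Real.exp (ζ / (Real.sqrt τ * Real.sqrt υ) *
        ∫ s in r..r + τ, ∫ t in u..u + υ,
          fderiv ℝ (f (s, t)) (W (s, t) ω) (EuclideanSpace.single i 1))) ∂P
      ≤ ENNReal.ofReal (2 * Real.exp 1) * gaussExpMoment d := by
  let h : ℕ → ℝ := fun n => 1 / ((n : ℝ) + 1)
  have hh : ∀ n, 0 < h n := fun n => Nat.one_div_pos_of_nat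
  have hh1 : ∀ n, h n ≤ 1 := fun n => by
    simp only [h]
    rw [div_le_one (by positivity)]
    linarith [(Nat.cast_nonneg n : (0 : ℝ) ≤ n)]
  let J : ℕ → Ω → ℝ := fun n ω => ∫ s in r..r + τ, ∫ t in u..u + υ,
    spaceDiffQuot f i (h n) (clampUnitSquare (s, t)) (W (clampUnitSquare (s, t)) ω)
  have hfc' : ∀ p, Continuous (f p) := fun p => (hf p).continuous
  have hJm : ∀ n, Measurable (J n) := fun n =>
    hW.measurable_integral_spaceDiffQuot hfc hfc' i (h n) hτ.le hυ.le
  have hrτ' : r ≤ r + τ := by linarith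
  have huυ' : u ≤ u + υ := by linarith
  have hJ0 : ∀ n ω, 0 ≤ J n ω := fun n ω =>
    intervalIntegral.integral_nonneg hrτ' fun s _ =>
      intervalIntegral.integral_nonneg huυ' fun t _ => spaceDiffQuot_nonneg hm i (hh n) _ _
  calc _ ≤ ∫⁻ ω, liminf (fun n => ENNReal.ofReal (Real.exp
        (ζ / (Real.sqrt τ * Real.sqrt υ) * J n ω))) atTop ∂P := by
        refine lintegral_mono fun ω => ofReal_exp_le_liminf (by positivity) (fun n => hJ0 n ω) ?_
        refine ofReal_integral_integral_le_liminf
          (φ := fun n p => spaceDiffQuot f i (h n) (clampUnitSquare p) (W (clampUnitSquare p) ω))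
          (ψ := fun p => fderiv ℝ (f p) (W p ω) (EuclideanSpace.single i 1))
          (fun n => continuous_spaceDiffQuot_clampUnitSquare hfc (hW.2.1 ω) i (h n))
          (fun n p => spaceDiffQuot_nonneg hm i (hh n) _ _) hrτ' huυ' fun s hs t ht => ?_
        have hst : (s, t) ∈ Set.Icc (0 : ℝ × ℝ) 1 :=
          ⟨⟨hr.trans hs.1.le, hu.trans ht.1.le⟩, ⟨hs.2.trans hrτ, ht.2.trans huυ⟩⟩
        simp only [clampUnitSquare_eq_self hst]
        exact tendsto_spaceDiffQuot (hf _) i _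
    _ ≤ liminf (fun n => ∫⁻ ω, ENNReal.ofReal (Real.exp
        (ζ / (Real.sqrt τ * Real.sqrt υ) * J n ω)) ∂P) atTop :=
        lintegral_liminf_le fun n => by
          have := hJm n
          fun_prop
    _ ≤ _ := liminf_le_of_frequently_le' <| Frequently.of_forall fun n =>
        hW.lintegral_exp_integral_spaceDiffQuot_le hfc hfc' hm hB hM hfM i (hh n) (hh1 n) hζ hζ1
          hr hτ hrτ hu hυ huυ

/-- uniform exponential moment estimate for averaged spatial partial
derivatives of smooth, componentwise nondecreasing functions of spatial linear growth. -/
theorem statement13 {Ω : Type*} [MeasurableSpace Ω] (P : Measure Ω) [IsProbabilityMeasure P]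
    (d : ℕ) (W : ℝ × ℝ → Ω → EuclideanSpace ℝ (Fin d)) (hW : IsBrownianSheet P d W)
    (M : ℝ) (hM : 0 < M) :
    ∃ ζ C : ℝ, 0 < ζ ∧ 0 < C ∧
      ∀ f : ℝ × ℝ → EuclideanSpace ℝ (Fin d) → ℝ,
        ContinuousOn (fun q : (ℝ × ℝ) × EuclideanSpace ℝ (Fin d) => f q.1 q.2)
          (Set.Icc (0 : ℝ × ℝ) 1 ×ˢ Set.univ) →
        (∀ p, ContDiff ℝ 1 (f p)) →
        (∀ p (x y : EuclideanSpace ℝ (Fin d)), (∀ i, x i ≤ y i) → f p x ≤ f p y) →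
        (∃ B : ℝ, ∀ p x, |f p x| ≤ B) →
        (∀ p x, |f p x| ≤ M * (1 + ‖x‖)) →
        ∀ i : Fin d,
        ∀ r s u t : ℝ, 0 < r → r < s → s ≤ 1 → 0 < u → u < t → t ≤ 1 →
          ∫⁻ ω, ENNReal.ofReal (Real.exp ((ζ / (Real.sqrt (s - r) * Real.sqrt (t - u))) *
              ∫ s₁ in r..s, ∫ t₁ in u..t,
                fderiv ℝ (f (s₁, t₁)) (W (s₁, t₁) ω) (EuclideanSpace.single i 1))) ∂P
            ≤ ENNReal.ofReal C := by
  have hJ0 : 0 ≤ (gaussExpMoment d).toReal := ENNReal.toReal_nonneg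
  refine ⟨1 / (8192 * M * ((gaussExpMoment d).toReal + 1)),
    2 * Real.exp 1 * (gaussExpMoment d).toReal + 1, by positivity, by positivity, ?_⟩
  rintro f hfc hf hm ⟨B, hB⟩ hfM i r s u t hr hrs hs hu hut ht
  have hζ1 : 8192 * M * (1 / (8192 * M * ((gaussExpMoment d).toReal + 1))) *
      (gaussExpMoment d).toReal ≤ 1 := by
    have : 8192 * M * (1 / (8192 * M * ((gaussExpMoment d).toReal + 1))) *
        (gaussExpMoment d).toReal =
        (gaussExpMoment d).toReal / ((gaussExpMoment d).toReal + 1) := by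
      field_simp
    rw [this, div_le_one (by positivity)]
    linarith
  have key := hW.lintegral_exp_integral_fderiv_le hfc (fun p => (hf p).differentiable one_ne_zero)
    hm hB hM hfM i (by positivity) hζ1 hr.le (sub_pos.2 hrs) (by linarith) hu.le (sub_pos.2 hut)
    (by linarith)
  rw [add_sub_cancel, add_sub_cancel] at key
  refine key.trans ?_
  rw [← ENNReal.ofReal_toReal (gaussExpMoment_ne_top d), ← ENNReal.ofReal_mul (by positivity),
    ENNReal.toReal_ofReal hJ0]
  exact ENNReal.ofReal_le_ofReal (by linarith)
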